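/- arXiv:1811.00514 — 2 statements merged into one kernel-verified Lean document; each statement's English description precedes it below -/
import Mathlib

section
/- For any domain $D\subset\mathbb{C}$ with $\overline{D}$ compact, the metric $\mathbb{d}_D^{\mathrm{LC}}$ on locally finite loop configurations on $D$ is complete and separable. -/
noncomputable section

open Set

/-- A parameterized loop: a continuous function on the circle `∂𝔻`, encoded as a
continuous `1`-periodic function `ℝ → ℂ`. -/
structure PLoop where
  toFun : ℝ → ℂ
  continuous_toFun : Continuous toFun
  periodic_toFun : Function.Periodic toFun 1

instance : Inhabited PLoop := ⟨⟨fun _ => 0, continuous_const, fun _ => rfl⟩⟩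

/-- Orientation-preserving reparameterization equivalence of parameterized loops. -/
def LoopEquiv (γ₁ γ₂ : PLoop) : Prop :=
  ∃ ψ : ℝ → ℝ, Continuous ψ ∧ StrictMono ψ ∧ (∀ x, ψ (x + 1) = ψ x + 1) ∧
    ∀ x, γ₁.toFun x = γ₂.toFun (ψ x)

/-- The uniform (sup) distance between two parameterized loops. -/
def unifDist (γ₁ γ₂ : PLoop) : ℝ :=
  ⨆ x : Set.Icc (0:ℝ) 1, dist (γ₁.toFun x) (γ₂.toFun x)

/-- `𝕕^Loop`: the infimum over parameterizations of the sup distance. -/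
def dLoop (γ₁ γ₂ : PLoop) : ℝ :=
  sInf {r | ∃ γ₁' γ₂' : PLoop, LoopEquiv γ₁' γ₁ ∧ LoopEquiv γ₂' γ₂ ∧ unifDist γ₁' γ₂' = r}

/-- The Euclidean diameter of a loop. -/
def loopDiam (γ : PLoop) : ℝ := Metric.diam (Set.range γ.toFun)

/-- The matching metric `𝕕^LC` on finite loop configurations (encoded as lists; the minimum
over permutations makes the order irrelevant): it is `1` if the cardinalities differ, and
otherwise `1 ∧ min_ψ ∑ 𝕕^Loop(γ, ψ(γ))` over bijections `ψ`. -/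
def dLCfin (l₁ l₂ : List PLoop) : ℝ :=
  if l₁.length = l₂.length then
    min 1 (sInf {r | ∃ l : List PLoop, l.Perm l₂ ∧ r = (List.zipWith dLoop l₁ l).sum})
  else 1

-- A countable loop configuration is encoded as a map `ℕ → Option PLoop` (so that
-- multiplicities are allowed).  `bigList s ε` is the finite configuration `Γ_ε` of loops of
-- diameter greater than `ε` (junk value if it is not finite).
open scoped Classical in
def bigList (s : ℕ → Option PLoop) (ε : ℝ) : List PLoop :=
  if h : {n : ℕ | ∃ γ, s n = some γ ∧ ε < loopDiam γ}.Finite then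
    (h.toFinset.sort (· ≤ ·)).map fun n => (s n).getD default
  else []

/-- The metric `𝕕_D^LC` on loop configurations:
`𝕕_D^LC(Γ¹,Γ²) = ∫_0^1 𝕕^LC(Γ¹_ε, Γ²_ε) dε`. -/
def dLCseq (s₁ s₂ : ℕ → Option PLoop) : ℝ :=
  ∫ ε in (0:ℝ)..1, dLCfin (bigList s₁ ε) (bigList s₂ ε)

/-- A locally finite loop configuration on `D`: a countable multiset of loops contained in
`closure D`, such that for every `ε > 0` and compact `A ⊆ closure D` only finitely many loops
of diameter greater than `ε` intersect `A`. -/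
def IsConfig (D : Set ℂ) (s : ℕ → Option PLoop) : Prop :=
  (∀ n γ, s n = some γ → Set.range γ.toFun ⊆ closure D) ∧
  ∀ ε : ℝ, 0 < ε → ∀ A : Set ℂ, IsCompact A → A ⊆ closure D →
    {n : ℕ | ∃ γ, s n = some γ ∧ ε < loopDiam γ ∧ (Set.range γ.toFun ∩ A).Nonempty}.Finite

namespace PLoop

instance : CoeFun PLoop fun _ => ℝ → ℂ := ⟨toFun⟩

/-- Reparameterizations of the circle, lifted to the real line. -/
def IsReparam (e : ℝ ≃o ℝ) : Prop := ∀ x, e (x + 1) = e x + 1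

lemma IsReparam.symm {e : ℝ ≃o ℝ} (he : IsReparam e) : IsReparam e.symm := fun x => by
  rw [OrderIso.symm_apply_eq, he, OrderIso.apply_symm_apply]

lemma IsReparam.trans {e f : ℝ ≃o ℝ} (he : IsReparam e) (hf : IsReparam f) :
    IsReparam (e.trans f) := fun x => by
  simp only [OrderIso.trans_apply, he x, hf _]

/-- The loop `γ` reparameterized by `e`. -/
def reparam (γ : PLoop) (e : ℝ ≃o ℝ) (he : IsReparam e) : PLoop where
  toFun x := γ (e x)
  continuous_toFun := γ.continuous_toFun.comp e.continuous
  periodic_toFun x := by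
    change γ (e (x + 1)) = γ (e x)
    rw [he, γ.periodic_toFun]

lemma loopEquiv_reparam (γ : PLoop) (e : ℝ ≃o ℝ) (he : IsReparam e) :
    LoopEquiv (γ.reparam e he) γ :=
  ⟨e, e.continuous, e.strictMono, he, fun _ => rfl⟩

lemma _root_.LoopEquiv.refl (γ : PLoop) : LoopEquiv γ γ :=
  ⟨id, continuous_id, strictMono_id, fun _ => rfl, fun _ => rfl⟩

lemma surjective_of_translation {ψ : ℝ → ℝ} (hc : Continuous ψ)
    (h1 : ∀ x, ψ (x + 1) = ψ x + 1) : Function.Surjective ψ := by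
  have hn : ∀ (x : ℝ) (n : ℕ), ψ (x + n) = ψ x + n := by
    intro x n
    induction n with
    | zero => simp
    | succ n ih => push_cast; rw [← add_assoc, h1, ih, add_assoc]
  intro y
  refine mem_range_of_exists_le_of_exists_ge hc ?_ ?_
  · obtain ⟨n, h⟩ := exists_nat_ge (ψ 0 - y)
    refine ⟨0 - n, ?_⟩
    have := hn (0 - n) n
    rw [sub_add_cancel] at this
    linarith
  · obtain ⟨n, h⟩ := exists_nat_ge (y - ψ 0)
    refine ⟨0 + n, ?_⟩
    rw [hn]
    linarith

lemma _root_.LoopEquiv.exists_reparam {γ₁ γ₂ : PLoop} (h : LoopEquiv γ₁ γ₂) :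
    ∃ e : ℝ ≃o ℝ, IsReparam e ∧ ∀ x, γ₁ x = γ₂ (e x) := by
  obtain ⟨ψ, hc, hm, h1, h⟩ := h
  exact ⟨hm.orderIsoOfSurjective ψ (surjective_of_translation hc h1), h1, h⟩

lemma exists_Icc_eq (γ₁ γ₂ : PLoop) (x : ℝ) :
    ∃ y : Icc (0 : ℝ) 1, γ₁ y = γ₁ x ∧ γ₂ y = γ₂ x := by
  refine ⟨⟨Int.fract x, Int.fract_nonneg x, (Int.fract_lt_one x).le⟩, ?_, ?_⟩
  · simpa using γ₁.periodic_toFun.sub_int_mul_eq (x := x) ⌊x⌋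
  · simpa using γ₂.periodic_toFun.sub_int_mul_eq (x := x) ⌊x⌋

lemma dist_le_unifDist (γ₁ γ₂ : PLoop) (x : ℝ) : dist (γ₁ x) (γ₂ x) ≤ unifDist γ₁ γ₂ := by
  obtain ⟨y, h₁, h₂⟩ := exists_Icc_eq γ₁ γ₂ x
  rw [← h₁, ← h₂]
  have hc : Continuous fun x : Icc (0 : ℝ) 1 => dist (γ₁ x) (γ₂ x) :=
    (γ₁.continuous_toFun.comp continuous_subtype_val).dist
      (γ₂.continuous_toFun.comp continuous_subtype_val)
  exact le_ciSup (isCompact_range hc).bddAbove y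

lemma dLoop_nonneg (γ₁ γ₂ : PLoop) : 0 ≤ dLoop γ₁ γ₂ := by
  refine Real.sInf_nonneg ?_
  rintro _ ⟨γ, γ', -, -, rfl⟩
  exact Real.iSup_nonneg fun _ => dist_nonneg

lemma dLoop_le {γ₁ γ₂ : PLoop} {e : ℝ ≃o ℝ} (he : IsReparam e) {r : ℝ}
    (h : ∀ x, dist (γ₁ x) (γ₂ (e x)) ≤ r) : dLoop γ₁ γ₂ ≤ r := by
  have hle : unifDist γ₁ (γ₂.reparam e he) ≤ r :=
    have : Nonempty (Icc (0 : ℝ) 1) := ⟨⟨0, by simp⟩⟩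
    ciSup_le fun x => h x
  refine le_trans (csInf_le ⟨0, ?_⟩ ⟨γ₁, _, .refl _, loopEquiv_reparam _ e he, rfl⟩) hle
  rintro _ ⟨γ, γ', -, -, rfl⟩
  exact Real.iSup_nonneg fun _ => dist_nonneg

lemma exists_reparam_of_dLoop_lt {γ₁ γ₂ : PLoop} {r : ℝ} (h : dLoop γ₁ γ₂ < r) :
    ∃ e : ℝ ≃o ℝ, IsReparam e ∧ ∀ x, dist (γ₁ x) (γ₂ (e x)) ≤ r := by
  obtain ⟨_, ⟨γ₁', γ₂', h₁, h₂, rfl⟩, hlt⟩ :=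
    exists_lt_of_csInf_lt (by exact ⟨_, γ₁, γ₂, .refl _, .refl _, rfl⟩) h
  obtain ⟨e₁, he₁, h₁⟩ := h₁.exists_reparam
  obtain ⟨e₂, he₂, h₂⟩ := h₂.exists_reparam
  refine ⟨e₁.symm.trans e₂, he₁.symm.trans he₂, fun x => ?_⟩
  have := (dist_le_unifDist γ₁' γ₂' (e₁.symm x)).trans hlt.le
  rwa [h₁, h₂, OrderIso.apply_symm_apply] at this

instance : PseudoMetricSpace PLoop where
  dist := dLoop
  dist_self γ := (dLoop_le (e := OrderIso.refl ℝ) (fun _ => rfl) (by simp)).antisymm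
    (dLoop_nonneg γ γ)
  dist_comm := by
    have key : ∀ γ₁ γ₂, dLoop γ₁ γ₂ ≤ dLoop γ₂ γ₁ := by
      refine fun γ₁ γ₂ => le_of_forall_pos_le_add fun ε hε => ?_
      obtain ⟨e, he, h⟩ := exists_reparam_of_dLoop_lt (lt_add_of_pos_right (dLoop γ₂ γ₁) hε)
      refine dLoop_le he.symm fun x => ?_
      simpa [dist_comm] using h (e.symm x)
    exact fun γ₁ γ₂ => (key _ _).antisymm (key _ _)
  dist_triangle γ₁ γ₂ γ₃ := by
    refine le_of_forall_pos_le_add fun ε hε => ?_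
    obtain ⟨e, he, h⟩ := exists_reparam_of_dLoop_lt
      (lt_add_of_pos_right (dLoop γ₁ γ₂) (half_pos hε))
    obtain ⟨f, hf, h'⟩ := exists_reparam_of_dLoop_lt
      (lt_add_of_pos_right (dLoop γ₂ γ₃) (half_pos hε))
    refine dLoop_le (he.trans hf) fun x => ?_
    have := dist_triangle (γ₁ x) (γ₂ (e x)) (γ₃ (f (e x)))
    have := h x
    have := h' (e x)
    simp only [OrderIso.trans_apply]
    linarith

lemma exists_dist_apply_le {γ₁ γ₂ : PLoop} {r : ℝ} (h : dist γ₁ γ₂ < r) (x : ℝ) :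
    ∃ y, dist (γ₁ x) (γ₂ y) ≤ r :=
  let ⟨e, _, he⟩ := exists_reparam_of_dLoop_lt h
  ⟨e x, he x⟩

lemma isBounded_range (γ : PLoop) : Bornology.IsBounded (range γ) := by
  refine (isCompact_Icc.image γ.continuous_toFun : IsCompact (γ '' Icc 0 1)).isBounded.subset ?_
  rintro _ ⟨x, rfl⟩
  obtain ⟨y, hy, -⟩ := exists_Icc_eq γ γ x
  exact ⟨y, y.2, hy⟩

lemma loopDiam_le_add (γ₁ γ₂ : PLoop) : loopDiam γ₁ ≤ loopDiam γ₂ + 2 * dist γ₁ γ₂ := by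
  refine le_of_forall_pos_le_add fun ε hε => ?_
  have hd : dist γ₁ γ₂ < dist γ₁ γ₂ + ε / 2 := by linarith
  have : 0 ≤ dist γ₁ γ₂ := dist_nonneg
  refine Metric.diam_le_of_forall_dist_le
    (by have : 0 ≤ loopDiam γ₂ := Metric.diam_nonneg
        linarith) ?_
  rintro _ ⟨x, rfl⟩ _ ⟨y, rfl⟩
  obtain ⟨x', hx⟩ := exists_dist_apply_le hd x
  obtain ⟨y', hy⟩ := exists_dist_apply_le hd y
  have h1 : dist (γ₂ x') (γ₂ y') ≤ loopDiam γ₂ :=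
    Metric.dist_le_diam_of_mem γ₂.isBounded_range ⟨x', rfl⟩ ⟨y', rfl⟩
  have h2 := dist_triangle4 (γ₁ x) (γ₂ x') (γ₂ y') (γ₁ y)
  rw [dist_comm (γ₂ y')] at h2
  linarith

lemma abs_loopDiam_sub_le (γ₁ γ₂ : PLoop) : |loopDiam γ₁ - loopDiam γ₂| ≤ 2 * dist γ₁ γ₂ := by
  have h₁ := loopDiam_le_add γ₁ γ₂
  have h₂ := loopDiam_le_add γ₂ γ₁
  rw [dist_comm] at h₂
  rw [abs_le]
  constructor <;> linarith

lemma isClosed_setOf_loopDiam_le (c : ℝ) : IsClosed {γ : PLoop | loopDiam γ ≤ c} := by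
  have : LipschitzWith 2 loopDiam := LipschitzWith.of_dist_le_mul fun γ₁ γ₂ => by
    simpa [Real.dist_eq] using abs_loopDiam_sub_le γ₁ γ₂
  exact isClosed_le this.continuous continuous_const

lemma isClosed_setOf_range_subset {K : Set ℂ} (hK : IsClosed K) :
    IsClosed {γ : PLoop | range γ ⊆ K} := by
  refine isClosed_of_closure_subset fun γ hγ => ?_
  rintro _ ⟨x, rfl⟩
  rw [← hK.closure_eq, Metric.mem_closure_iff]
  intro ε hε
  obtain ⟨γ', hγ', hd⟩ := Metric.mem_closure_iff.1 hγ (ε / 2) (half_pos hε)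
  obtain ⟨y, hy⟩ := exists_dist_apply_le hd x
  exact ⟨γ' y, hγ' ⟨y, rfl⟩, by linarith⟩

instance : CompleteSpace PLoop := by
  refine Metric.complete_of_convergent_controlled_sequences (fun n => 1 / 2 ^ n)
    (fun n => by positivity) fun u hu => ?_
  have hstep : ∀ n, ∃ e : ℝ ≃o ℝ, IsReparam e ∧
      ∀ x, dist (u n x) (u (n + 1) (e x)) ≤ 1 / 2 ^ n := fun n =>
    exists_reparam_of_dLoop_lt (hu n n (n + 1) le_rfl n.le_succ)
  choose e he hdist using hstep
  let E : ℕ → ℝ ≃o ℝ := fun n => Nat.rec (OrderIso.refl ℝ) (fun k E => E.trans (e k)) n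
  have hE : ∀ n, IsReparam (E n) := fun n => by
    induction n with
    | zero => exact fun _ => rfl
    | succ n ih => exact ih.trans (he n)
  have hv : ∀ x n, dist (u n (E n x)) (u (n + 1) (E (n + 1) x)) ≤ 2 / 2 / 2 ^ n := fun x n => by
    rw [div_self two_ne_zero]
    exact hdist n (E n x)
  have hlim : ∀ x, ∃ z, Filter.Tendsto (fun n => u n (E n x)) Filter.atTop (nhds z) := fun x =>
    cauchySeq_tendsto_of_complete (cauchySeq_of_le_geometric_two (hv x))
  choose f hf using hlim
  have hbd : ∀ x n, dist (u n (E n x)) (f x) ≤ 2 / 2 ^ n := fun x n =>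
    dist_le_of_le_geometric_two_of_tendsto (hv x) (hf x) n
  have hsmall : Filter.Tendsto (fun n : ℕ => (2 : ℝ) / 2 ^ n) Filter.atTop (nhds 0) := by
    simpa [div_eq_mul_inv] using
      (tendsto_pow_atTop_nhds_zero_of_lt_one (r := (2⁻¹ : ℝ)) (by norm_num)
        (by norm_num)).const_mul 2
  have hcont : Continuous f := by
    refine TendstoUniformly.continuous (F := fun n x => u n (E n x)) (p := Filter.atTop) ?_
      (Filter.Frequently.of_forall fun n => (u n).continuous_toFun.comp (E n).continuous)
    rw [Metric.tendstoUniformly_iff]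
    intro ε hε
    filter_upwards [hsmall.eventually_lt_const hε] with n hn x
    rw [dist_comm]
    exact (hbd x n).trans_lt hn
  refine ⟨⟨f, hcont, fun x => tendsto_nhds_unique (hf (x + 1)) ?_⟩, ?_⟩
  · refine (hf x).congr fun n => ?_
    rw [hE n, (u n).periodic_toFun]
  · rw [tendsto_iff_dist_tendsto_zero]
    refine squeeze_zero (fun _ => dist_nonneg) (fun n => ?_) hsmall
    rw [dist_comm]
    refine dLoop_le (hE n) fun x => ?_
    rw [dist_comm]
    exact hbd x n

/-- The restriction of a loop to the unit interval. -/
def toC (γ : PLoop) : C(Icc (0 : ℝ) 1, ℂ) :=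
  ⟨fun x => γ x, γ.continuous_toFun.comp continuous_subtype_val⟩

lemma dist_le_dist_toC (γ₁ γ₂ : PLoop) : dist γ₁ γ₂ ≤ dist γ₁.toC γ₂.toC := by
  refine dLoop_le (e := OrderIso.refl ℝ) (fun _ => rfl) fun x => ?_
  obtain ⟨y, h₁, h₂⟩ := exists_Icc_eq γ₁ γ₂ x
  rw [OrderIso.refl_apply, ← h₁, ← h₂]
  exact ContinuousMap.dist_apply_le_dist (f := γ₁.toC) (g := γ₂.toC) y

lemma exists_countable_approx (X : Set PLoop) :
    ∃ Q ⊆ X, Q.Countable ∧ ∀ γ ∈ X, ∀ ε > 0, ∃ q ∈ Q, dist γ q < ε := by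
  obtain ⟨c, hcX, hc, hd⟩ :=
    (TopologicalSpace.IsSeparable.of_separableSpace (toC '' X)).exists_countable_dense_subset
  have hcX' : ∀ z ∈ c, ∃ γ ∈ X, toC γ = z := fun z hz => hcX hz
  choose! p hpX hp using hcX'
  refine ⟨p '' c, image_subset_iff.2 hpX, hc.image p, fun γ hγ ε hε => ?_⟩
  obtain ⟨z, hz, hdist⟩ := Metric.mem_closure_iff.1 (hd (mem_image_of_mem toC hγ)) ε hε
  rw [← hp z hz] at hdist
  exact ⟨p z, mem_image_of_mem p hz, (dist_le_dist_toC _ _).trans_lt hdist⟩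

end PLoop

/-- `A` and `B` can be matched bijectively with total cost at most `r`. -/
def Matching {α : Type*} [PseudoMetricSpace α] (A B : Multiset α) (r : ℝ) : Prop :=
  ∃ P : Multiset (α × α), P.map Prod.fst = A ∧ P.map Prod.snd = B ∧
    (P.map fun p => dist p.1 p.2).sum ≤ r

namespace Matching

variable {α : Type*} [PseudoMetricSpace α] {A B C A' B' : Multiset α} {r s : ℝ}

lemma sum_dist_nonneg (P : Multiset (α × α)) : 0 ≤ (P.map fun p => dist p.1 p.2).sum :=
  Multiset.sum_nonneg fun x hx => by
    obtain ⟨p, -, rfl⟩ := Multiset.mem_map.1 hx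
    exact dist_nonneg

lemma mono (h : Matching A B r) (hrs : r ≤ s) : Matching A B s := by
  obtain ⟨P, h₁, h₂, hr⟩ := h
  exact ⟨P, h₁, h₂, hr.trans hrs⟩

lemma refl (A : Multiset α) : Matching A A 0 :=
  ⟨A.map fun a => (a, a), by simp, by simp, by simp⟩

lemma symm (h : Matching A B r) : Matching B A r := by
  obtain ⟨P, rfl, rfl, hr⟩ := h
  exact ⟨P.map Prod.swap, by simp, by simp, by simpa [dist_comm] using hr⟩

lemma add (h : Matching A B r) (h' : Matching A' B' s) :
    Matching (A + A') (B + B') (r + s) := by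
  obtain ⟨P, rfl, rfl, hr⟩ := h
  obtain ⟨Q, rfl, rfl, hs⟩ := h'
  exact ⟨P + Q, by simp, by simp, by simpa using add_le_add hr hs⟩

lemma card_eq (h : Matching A B r) : A.card = B.card := by
  obtain ⟨P, rfl, rfl, -⟩ := h
  simp

lemma _root_.Multiset.exists_cons_of_map_eq_cons {β γ : Type*} {f : β → γ} {P : Multiset β}
    {a : γ} {A : Multiset γ} (h : P.map f = a ::ₘ A) :
    ∃ b P', P = b ::ₘ P' ∧ f b = a ∧ P'.map f = A := by
  obtain ⟨b, hb, hba⟩ := Multiset.mem_map.1 (h ▸ Multiset.mem_cons_self a A)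
  obtain ⟨P', rfl⟩ := Multiset.exists_cons_of_mem hb
  refine ⟨b, P', rfl, hba, ?_⟩
  rwa [Multiset.map_cons, hba, Multiset.cons_inj_right] at h

lemma trans (h : Matching A B r) (h' : Matching B C s) : Matching A C (r + s) := by
  obtain ⟨P, rfl, rfl, hr⟩ := h
  obtain ⟨Q, hQ, rfl, hs⟩ := h'
  refine mono (r := (P.map fun p => dist p.1 p.2).sum + (Q.map fun p => dist p.1 p.2).sum) ?_
    (add_le_add hr hs)
  clear hr hs
  induction P using Multiset.induction generalizing Q with
  | empty =>
    obtain rfl : Q = 0 := by simpa using hQ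
    simpa using refl (0 : Multiset α)
  | cons p P ih =>
    rw [Multiset.map_cons] at hQ
    obtain ⟨q, Q, rfl, hq, hQ⟩ := Multiset.exists_cons_of_map_eq_cons hQ
    obtain ⟨R, h₁, h₂, hR⟩ := ih Q hQ
    refine ⟨(p.1, q.2) ::ₘ R, by simp [h₁], by simp [h₂], ?_⟩
    have := dist_triangle p.1 p.2 q.2
    simp only [Multiset.map_cons, Multiset.sum_cons, hq] at hR ⊢
    linarith

lemma of_cons {a : α} (h : Matching (a ::ₘ A) (a ::ₘ B) r) : Matching A B r := by
  obtain ⟨P, h₁, h₂, hr⟩ := h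
  obtain ⟨⟨a, b⟩, P, rfl, rfl, hP⟩ := Multiset.exists_cons_of_map_eq_cons h₁
  clear h₁
  simp only [Multiset.map_cons, Multiset.sum_cons] at h₂ hr
  have hnn : 0 ≤ dist a b := dist_nonneg
  by_cases hab : a = b
  · subst hab
    exact ⟨P, hP, by simpa using h₂, by linarith⟩
  · have ha : a ∈ P.map Prod.snd := by
      have := h₂ ▸ Multiset.mem_cons_self a B
      exact (Multiset.mem_cons.1 this).resolve_left hab
    obtain ⟨⟨c, a⟩, hmem, rfl⟩ := Multiset.mem_map.1 ha
    obtain ⟨P, rfl⟩ := Multiset.exists_cons_of_mem hmem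
    simp only [Multiset.map_cons, Multiset.sum_cons] at hP h₂ hr hab
    refine ⟨(c, b) ::ₘ P, by simpa using hP, ?_, ?_⟩
    · rw [Multiset.cons_swap, Multiset.cons_inj_right] at h₂
      simpa using h₂
    · have := dist_triangle c a b
      simp only [Multiset.map_cons, Multiset.sum_cons] at hr ⊢
      linarith

lemma of_add (h : Matching (C + A) (C + B) r) : Matching A B r := by
  induction C using Multiset.induction with
  | empty => simpa using h
  | cons c C ih =>
    rw [Multiset.cons_add, Multiset.cons_add] at h
    exact ih h.of_cons

lemma sub (h : Matching (A + A') (B + B') r) (h' : Matching A' B' s) :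
    Matching A B (r + s) := by
  refine of_add (C := A' + B') ?_
  convert h.add h'.symm using 1 <;> abel

lemma exists_mem_dist_le (h : Matching A B r) {b : α} (hb : b ∈ B) :
    ∃ a ∈ A, dist a b ≤ r := by
  obtain ⟨P, rfl, rfl, hr⟩ := h
  obtain ⟨p, hp, rfl⟩ := Multiset.mem_map.1 hb
  refine ⟨p.1, Multiset.mem_map_of_mem _ hp, le_trans ?_ hr⟩
  obtain ⟨P, rfl⟩ := Multiset.exists_cons_of_mem hp
  have := sum_dist_nonneg P
  simp only [Multiset.map_cons, Multiset.sum_cons]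
  linarith

lemma filter (h : Matching A B r) {p : α → Prop} [DecidablePred p]
    (hp : ∀ a ∈ A, ∀ b ∈ B, dist a b ≤ r → (p a ↔ p b)) :
    Matching (A.filter p) (B.filter p) r := by
  obtain ⟨P, rfl, rfl, hr⟩ := h
  refine ⟨P.filter (p ·.1), by rw [Multiset.filter_map]; rfl, ?_, le_trans ?_ hr⟩
  · rw [Multiset.filter_map]
    congr 1
    refine Multiset.filter_congr fun x hx => ?_
    refine hp _ (Multiset.mem_map_of_mem _ hx) _ (Multiset.mem_map_of_mem _ hx) (le_trans ?_ hr)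
    obtain ⟨P, rfl⟩ := Multiset.exists_cons_of_mem hx
    have := sum_dist_nonneg P
    simp only [Multiset.map_cons, Multiset.sum_cons]
    linarith
  · have := sum_dist_nonneg (P.filter fun x => ¬ p x.1)
    conv_rhs => rw [← Multiset.filter_add_not (fun x => p x.1) P]
    rw [Multiset.map_add, Multiset.sum_add]
    linarith

lemma _root_.Multiset.exists_of_map_eq_finset_map {ι β γ : Type*} [Nonempty β] {f : β → γ}
    {g : ι → γ} (t : Finset ι) {P : Multiset β} (h : P.map f = t.val.map g) :
    ∃ u : ι → β, t.val.map u = P ∧ ∀ i ∈ t, f (u i) = g i := by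
  classical
  induction t using Finset.induction generalizing P with
  | empty =>
    obtain rfl : P = 0 := by simpa using h
    exact ⟨fun _ => Classical.arbitrary β, by simp⟩
  | insert i t hi ih =>
    rw [Finset.insert_val_of_notMem hi, Multiset.map_cons] at h
    obtain ⟨b, P, rfl, hb, h⟩ := Multiset.exists_cons_of_map_eq_cons h
    obtain ⟨u, rfl, hu⟩ := ih h
    have hne : ∀ j ∈ t, j ≠ i := fun j hj hji => hi (hji ▸ hj)
    refine ⟨Function.update u i b, ?_, ?_⟩
    · rw [Finset.insert_val_of_notMem hi, Multiset.map_cons, Function.update_self]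
      congr 1
      exact Multiset.map_congr rfl fun j hj => Function.update_of_ne (hne j hj) _ _
    · intro j hj
      rcases Finset.mem_insert.1 hj with rfl | hj
      · simpa using hb
      · rw [Function.update_of_ne (hne j hj)]
        exact hu j hj

lemma exists_enum {ι : Type*} [Fintype ι] {w : ι → α}
    (h : Matching (Finset.univ.val.map w) B r) :
    ∃ w' : ι → α, Finset.univ.val.map w' = B ∧ ∑ i, dist (w i) (w' i) ≤ r := by
  obtain ⟨P, h₁, rfl, hr⟩ := h
  rcases isEmpty_or_nonempty ι with hι | ⟨⟨i₀⟩⟩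
  · obtain rfl : P = 0 := by simpa using h₁
    exact ⟨w, by simp, by simpa using hr⟩
  · have : Nonempty (α × α) := ⟨(w i₀, w i₀)⟩
    obtain ⟨u, rfl, hu⟩ := Multiset.exists_of_map_eq_finset_map _ h₁
    refine ⟨fun i => (u i).2, by simp, ?_⟩
    rw [Multiset.map_map] at hr
    refine le_trans (le_of_eq (Finset.sum_congr rfl fun i hi => ?_)) hr
    simp [hu i hi]

lemma of_enum {ι : Type*} [Fintype ι] {w w' : ι → α} (h : ∑ i, dist (w i) (w' i) ≤ r) :
    Matching (Finset.univ.val.map w) (Finset.univ.val.map w') r :=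
  ⟨Finset.univ.val.map fun i => (w i, w' i), by simp, by simp, by
    rw [Multiset.map_map]; exact h⟩

lemma _root_.Multiset.exists_fin_enum {β : Type*} (A : Multiset β) :
    ∃ (N : ℕ) (w : Fin N → β), Finset.univ.val.map w = A := by
  induction A using Quotient.inductionOn with
  | h l => exact ⟨l.length, l.get, by rw [Fin.univ_val_map, List.ofFn_get]; rfl⟩

/-- A sequence of finite multisets whose successive matching costs are summable converges. -/
lemma exists_limit [CompleteSpace α] {A : ℕ → Multiset α} {r : ℕ → ℝ} (hr : Summable r)
    (h : ∀ᶠ k in Filter.atTop, Matching (A k) (A (k + 1)) (r k)) :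
    ∃ B, ∀ ε > 0, ∀ᶠ k in Filter.atTop, Matching (A k) B ε := by
  obtain ⟨K, hK⟩ := Filter.eventually_atTop.1 h
  obtain ⟨N, w₀, hw₀⟩ := Multiset.exists_fin_enum (A K)
  have hstep : ∀ k (w : {w : Fin N → α // Finset.univ.val.map w = A (K + k)}),
      ∃ w' : {w : Fin N → α // Finset.univ.val.map w = A (K + (k + 1))},
        ∑ i, dist (w.1 i) (w'.1 i) ≤ r (K + k) := by
    rintro k ⟨w, hw⟩
    obtain ⟨w', hw', hd⟩ := exists_enum (hw ▸ hK (K + k) (Nat.le_add_right _ _))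
    exact ⟨⟨w', hw'⟩, hd⟩
  choose next hnext using hstep
  let w : ∀ k, {w : Fin N → α // Finset.univ.val.map w = A (K + k)} :=
    fun k => Nat.rec ⟨w₀, hw₀⟩ next k
  have hw : ∀ k, ∑ i, dist ((w k).1 i) ((w (k + 1)).1 i) ≤ r (K + k) := fun k => hnext k (w k)
  have hr' : Summable fun k => r (K + k) := by
    simpa only [add_comm K] using (summable_nat_add_iff K).2 hr
  have hlim : ∀ i, ∃ z, Filter.Tendsto (fun k => (w k).1 i) Filter.atTop (nhds z) := fun i =>
    cauchySeq_tendsto_of_complete <| cauchySeq_of_summable_dist <|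
      Summable.of_nonneg_of_le (fun _ => dist_nonneg) (fun k =>
        (Finset.single_le_sum (f := fun i => dist ((w k).1 i) ((w (k + 1)).1 i))
          (fun _ _ => dist_nonneg) (Finset.mem_univ i)).trans (hw k)) hr'
  choose z hz using hlim
  refine ⟨Finset.univ.val.map z, fun ε hε => ?_⟩
  have hsum : Filter.Tendsto (fun k => ∑ i, dist ((w k).1 i) (z i)) Filter.atTop (nhds 0) := by
    simpa using tendsto_finsetSum Finset.univ
      fun i _ => tendsto_iff_dist_tendsto_zero.1 (hz i)
  obtain ⟨k₀, hk₀⟩ := Filter.eventually_atTop.1 (hsum.eventually_le_const hε)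
  refine Filter.eventually_atTop.2 ⟨K + k₀, fun k hk => ?_⟩
  obtain ⟨m, rfl⟩ := Nat.exists_eq_add_of_le (show K ≤ k by omega)
  rw [← (w m).2]
  exact of_enum (hk₀ m (by omega))

lemma mem_of_isClosed {A : ℕ → Multiset α} {F : Set α} (hF : IsClosed F)
    (h : ∀ ε > 0, ∀ᶠ k in Filter.atTop, Matching (A k) B ε)
    (hA : ∀ k, ∀ a ∈ A k, a ∈ F) {b : α} (hb : b ∈ B) : b ∈ F := by
  rw [← hF.closure_eq, Metric.mem_closure_iff]
  intro ε hε
  obtain ⟨k, hk⟩ := (h (ε / 2) (half_pos hε)).exists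
  obtain ⟨a, ha, hd⟩ := hk.exists_mem_dist_le hb
  exact ⟨a, hA k a ha, by rw [dist_comm]; linarith⟩

lemma exists_approx {Q : Set α} (A : Multiset α)
    (hA : ∀ a ∈ A, ∀ ε > 0, ∃ q ∈ Q, dist a q < ε) (hε : 0 < r) :
    ∃ l : List Q, Matching A (l.map (↑) : List α) r := by
  induction A using Multiset.induction generalizing r with
  | empty => exact ⟨[], (refl 0).mono hε.le⟩
  | cons a A ih =>
    obtain ⟨l, hl⟩ := ih (fun b hb => hA b (Multiset.mem_cons_of_mem hb)) (half_pos hε)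
    obtain ⟨q, hq, hd⟩ := hA a (Multiset.mem_cons_self a A) (r / 2) (half_pos hε)
    refine ⟨⟨q, hq⟩ :: l, ?_⟩
    have h₁ : Matching {a} {q} (r / 2) := ⟨{(a, q)}, by simp, by simp, by simpa using hd.le⟩
    simpa using h₁.add hl

end Matching

lemma dLCfin_nonneg (l₁ l₂ : List PLoop) : 0 ≤ dLCfin l₁ l₂ := by
  unfold dLCfin
  split_ifs
  · refine le_min zero_le_one (Real.sInf_nonneg ?_)
    rintro _ ⟨l, -, rfl⟩
    refine List.sum_nonneg fun x hx => ?_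
    rw [List.zipWith_eq_zipWith_take_min, ← List.map_uncurry_zip_eq_zipWith] at hx
    obtain ⟨p, -, rfl⟩ := List.mem_map.1 hx
    exact PLoop.dLoop_nonneg _ _
  · exact zero_le_one

lemma dLCfin_le_one (l₁ l₂ : List PLoop) : dLCfin l₁ l₂ ≤ 1 := by
  unfold dLCfin
  split_ifs
  · exact min_le_left _ _
  · exact le_rfl

lemma List.exists_of_coe_map_eq {β γ : Type*} {f : β → γ} {l : List γ} {P : Multiset β}
    (h : P.map f = l) : ∃ p : List β, (p : Multiset β) = P ∧ p.map f = l := by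
  induction l generalizing P with
  | nil =>
    obtain rfl : P = 0 := by simpa using h
    exact ⟨[], rfl, rfl⟩
  | cons c l ih =>
    obtain ⟨b, P, rfl, rfl, hP⟩ := Multiset.exists_cons_of_map_eq_cons (A := (l : Multiset γ)) h
    obtain ⟨p, rfl, rfl⟩ := ih hP
    exact ⟨b :: p, rfl, rfl⟩

lemma dLCfin_le_of_matching {l₁ l₂ : List PLoop} {r : ℝ}
    (h : Matching (l₁ : Multiset PLoop) l₂ r) : dLCfin l₁ l₂ ≤ r := by
  have hcard := h.card_eq
  obtain ⟨P, h₁, h₂, hr⟩ := h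
  obtain ⟨p, rfl, rfl⟩ := List.exists_of_coe_map_eq h₁
  unfold dLCfin
  rw [if_pos (by simpa using hcard)]
  refine (min_le_right _ _).trans (le_trans (csInf_le ⟨0, ?_⟩ ?_) hr)
  · rintro _ ⟨l, -, rfl⟩
    refine List.sum_nonneg fun x hx => ?_
    rw [← List.map_uncurry_zip_eq_zipWith] at hx
    obtain ⟨p, -, rfl⟩ := List.mem_map.1 hx
    exact PLoop.dLoop_nonneg _ _
  · refine ⟨p.map Prod.snd, Multiset.coe_eq_coe.1 h₂, ?_⟩
    rw [List.zipWith_map, List.zipWith_self]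
    rfl

lemma matching_of_dLCfin_lt {l₁ l₂ : List PLoop} (h : dLCfin l₁ l₂ < 1) :
    Matching (l₁ : Multiset PLoop) l₂ (dLCfin l₁ l₂) := by
  unfold dLCfin at h ⊢
  split_ifs at h ⊢ with hlen
  · rw [min_lt_iff, or_iff_right (lt_irrefl _)] at h
    rw [min_eq_right h.le]
    have hfin : {r | ∃ l : List PLoop, l.Perm l₂ ∧ r = (List.zipWith dLoop l₁ l).sum}.Finite := by
      refine ((List.finite_toSet l₂.permutations).image
        fun l => (List.zipWith dLoop l₁ l).sum).subset ?_
      rintro _ ⟨l, hl, rfl⟩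
      exact ⟨l, List.mem_permutations.2 hl, rfl⟩
    obtain ⟨l, hl, hr⟩ := Set.Nonempty.csInf_mem (by exact ⟨_, l₂, List.Perm.refl _, rfl⟩) hfin
    have hlen' : l₁.length = l.length := hlen.trans hl.length_eq.symm
    refine ⟨(l₁.zip l : List (PLoop × PLoop)), ?_, ?_, ?_⟩
    · rw [Multiset.map_coe, List.map_fst_zip hlen'.le]
    · rw [Multiset.map_coe, List.map_snd_zip hlen'.ge]
      exact Multiset.coe_eq_coe.2 hl
    · rw [hr, Multiset.map_coe, Multiset.sum_coe, ← List.map_uncurry_zip_eq_zipWith]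
      rfl
  · exact absurd h (lt_irrefl _)

lemma dLCfin_triangle (l₁ l₂ l₃ : List PLoop) :
    dLCfin l₁ l₃ ≤ dLCfin l₁ l₂ + dLCfin l₂ l₃ := by
  have h₁₂ := dLCfin_nonneg l₁ l₂
  have h₂₃ := dLCfin_nonneg l₂ l₃
  have h₁₃ := dLCfin_le_one l₁ l₃
  rcases lt_or_ge (dLCfin l₁ l₂) 1 with h | h
  · rcases lt_or_ge (dLCfin l₂ l₃) 1 with h' | h'
    · exact dLCfin_le_of_matching ((matching_of_dLCfin_lt h).trans (matching_of_dLCfin_lt h'))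
    · linarith
  · linarith

open scoped Classical in
/-- The indices of the loops of diameter greater than `t` (empty if there are infinitely many). -/
def bigIdx (s : ℕ → Option PLoop) (t : ℝ) : Finset ℕ :=
  if h : {n : ℕ | ∃ γ, s n = some γ ∧ t < loopDiam γ}.Finite then h.toFinset else ∅

lemma bigList_eq (s : ℕ → Option PLoop) (t : ℝ) :
    bigList s t = ((bigIdx s t).sort (· ≤ ·)).map fun n => (s n).getD default := by
  unfold bigList bigIdx
  split_ifs <;> simp

lemma coe_bigList (s : ℕ → Option PLoop) (t : ℝ) :
    (bigList s t : Multiset PLoop) = (bigIdx s t).val.map fun n => (s n).getD default := by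
  rw [bigList_eq, ← Multiset.map_coe, Finset.sort_eq]

lemma mem_bigIdx {s : ℕ → Option PLoop} {t : ℝ}
    (h : {n : ℕ | ∃ γ, s n = some γ ∧ t < loopDiam γ}.Finite) {n : ℕ} :
    n ∈ bigIdx s t ↔ ∃ γ, s n = some γ ∧ t < loopDiam γ := by
  unfold bigIdx
  rw [dif_pos h, Set.Finite.mem_toFinset, mem_ofPred_eq]

lemma mem_bigList {s : ℕ → Option PLoop} {t : ℝ}
    (h : {n : ℕ | ∃ γ, s n = some γ ∧ t < loopDiam γ}.Finite) {γ : PLoop}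
    (hγ : γ ∈ (bigList s t : Multiset PLoop)) : ∃ n, s n = some γ ∧ t < loopDiam γ := by
  rw [coe_bigList] at hγ
  obtain ⟨n, hn, rfl⟩ := Multiset.mem_map.1 hγ
  obtain ⟨γ, hs, hd⟩ := (mem_bigIdx h).1 hn
  exact ⟨n, by simp [hs], by simpa [hs] using hd⟩

open scoped Classical in
lemma filter_bigList {s : ℕ → Option PLoop} {t t' : ℝ}
    (h : {n : ℕ | ∃ γ, s n = some γ ∧ t' < loopDiam γ}.Finite) (ht : t' ≤ t) :
    (bigList s t' : Multiset PLoop).filter (t < loopDiam ·) = bigList s t := by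
  have h' : {n : ℕ | ∃ γ, s n = some γ ∧ t < loopDiam γ}.Finite :=
    h.subset fun n ⟨γ, hs, hd⟩ => ⟨γ, hs, ht.trans_lt hd⟩
  rw [coe_bigList, coe_bigList, Multiset.filter_map, ← Finset.filter_val]
  congr 2
  ext n
  rw [Finset.mem_filter, mem_bigIdx h, mem_bigIdx h']
  constructor
  · rintro ⟨⟨γ, hs, -⟩, hd⟩
    exact ⟨γ, hs, by simpa [hs] using hd⟩
  · rintro ⟨γ, hs, hd⟩
    exact ⟨⟨γ, hs, ht.trans_lt hd⟩, by simpa [hs] using hd⟩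

lemma ordConnected_setOf_big (s : ℕ → Option PLoop) (p : Set ℕ → Prop)
    (hp : ∀ A B C : Set ℕ, A ⊆ B → B ⊆ C → p A → p C → p B) :
    OrdConnected {t : ℝ | p {n : ℕ | ∃ γ, s n = some γ ∧ t < loopDiam γ}} := by
  refine ⟨fun a ha b hb c hc => hp _ _ _ ?_ ?_ hb ha⟩
  · exact fun n ⟨γ, hs, hd⟩ => ⟨γ, hs, hc.2.trans_lt hd⟩
  · exact fun n ⟨γ, hs, hd⟩ => ⟨γ, hs, hc.1.trans_lt hd⟩

lemma measurableSet_bigIdx_eq (s : ℕ → Option PLoop) (F : Finset ℕ) :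
    MeasurableSet {t : ℝ | bigIdx s t = F} := by
  have h₁ := (ordConnected_setOf_big s (· = (F : Set ℕ)) fun A B C hAB hBC hA hC =>
    (hC ▸ hBC).antisymm (hA ▸ hAB)).measurableSet
  have h₂ := (ordConnected_setOf_big s (fun A => ¬ A.Finite) fun A B C hAB hBC hA _ hB =>
    hA (hB.subset hAB)).measurableSet
  have : {t : ℝ | bigIdx s t = F} =
      {t : ℝ | {n : ℕ | ∃ γ, s n = some γ ∧ t < loopDiam γ} = (F : Set ℕ)} ∪
      ({t : ℝ | ¬ {n : ℕ | ∃ γ, s n = some γ ∧ t < loopDiam γ}.Finite} ∩ {_t | F = ∅}) := by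
    ext t
    by_cases h : {n : ℕ | ∃ γ, s n = some γ ∧ t < loopDiam γ}.Finite
    · have hset : {n : ℕ | ∃ γ, s n = some γ ∧ t < loopDiam γ} = (bigIdx s t : Set ℕ) := by
        ext n
        exact (mem_bigIdx h).symm
      refine ⟨fun hF => Or.inl (hset.trans (congrArg _ hF)), ?_⟩
      rintro (hF | hF)
      · exact Finset.coe_injective (hset.symm.trans hF)
      · exact absurd h hF.1
    · have hempty : bigIdx s t = ∅ := by
        unfold bigIdx
        rw [dif_neg h]
      refine ⟨fun hF => Or.inr ⟨h, hF.symm.trans hempty⟩, ?_⟩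
      rintro (hF | hF)
      · exact absurd (hF ▸ F.finite_toSet) h
      · exact hempty.trans hF.2.symm
  rw [this]
  exact h₁.union (h₂.inter (MeasurableSet.const _))

lemma measurable_dLCfin_bigList (s₁ s₂ : ℕ → Option PLoop) :
    Measurable fun t => dLCfin (bigList s₁ t) (bigList s₂ t) := by
  let _ : MeasurableSpace (Finset ℕ × Finset ℕ) := ⊤
  have hF : Measurable fun t : ℝ => (bigIdx s₁ t, bigIdx s₂ t) := by
    refine measurable_to_countable' fun F => ?_
    convert (measurableSet_bigIdx_eq s₁ F.1).inter (measurableSet_bigIdx_eq s₂ F.2) using 1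
    ext t
    simp [Prod.ext_iff]
  have : (fun t => dLCfin (bigList s₁ t) (bigList s₂ t)) =
      (fun F : Finset ℕ × Finset ℕ =>
        dLCfin ((F.1.sort (· ≤ ·)).map fun n => (s₁ n).getD default)
          ((F.2.sort (· ≤ ·)).map fun n => (s₂ n).getD default)) ∘
      fun t : ℝ => (bigIdx s₁ t, bigIdx s₂ t) := by
    ext t
    simp only [bigList_eq, Function.comp_apply]
  rw [this]
  exact measurable_from_top.comp hF

lemma intervalIntegrable_dLCfin_bigList (s₁ s₂ : ℕ → Option PLoop) :
    IntervalIntegrable (fun t => dLCfin (bigList s₁ t) (bigList s₂ t)) MeasureTheory.volume 0 1 := by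
  refine (intervalIntegrable_const (c := (1 : ℝ))).mono_fun
    (measurable_dLCfin_bigList s₁ s₂).aestronglyMeasurable (Filter.Eventually.of_forall fun t => ?_)
  dsimp only
  rw [Real.norm_of_nonneg (dLCfin_nonneg _ _), norm_one]
  exact dLCfin_le_one _ _

lemma dLCseq_triangle (s₁ s₂ s₃ : ℕ → Option PLoop) :
    dLCseq s₁ s₃ ≤ dLCseq s₁ s₂ + dLCseq s₂ s₃ := by
  unfold dLCseq
  rw [← intervalIntegral.integral_add (intervalIntegrable_dLCfin_bigList _ _)
    (intervalIntegrable_dLCfin_bigList _ _)]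
  exact intervalIntegral.integral_mono_on zero_le_one (intervalIntegrable_dLCfin_bigList _ _)
    ((intervalIntegrable_dLCfin_bigList _ _).add (intervalIntegrable_dLCfin_bigList _ _))
    fun t _ => dLCfin_triangle _ _ _

lemma dLCseq_nonneg (s₁ s₂ : ℕ → Option PLoop) : 0 ≤ dLCseq s₁ s₂ :=
  intervalIntegral.integral_nonneg zero_le_one fun _ _ => dLCfin_nonneg _ _

lemma tendsto_dLCseq {Γ Δ : ℕ → ℕ → Option PLoop} {E : Set ℝ} (hE : E.Countable)
    (h : ∀ t, 0 < t → t ∉ E → ∀ ε > 0, ∀ᶠ k in Filter.atTop,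
      Matching (bigList (Γ k) t : Multiset PLoop) (bigList (Δ k) t) ε) :
    Filter.Tendsto (fun k => dLCseq (Γ k) (Δ k)) Filter.atTop (nhds 0) := by
  have := intervalIntegral.tendsto_integral_filter_of_dominated_convergence
    (F := fun k t => dLCfin (bigList (Γ k) t) (bigList (Δ k) t)) (f := fun _ => (0 : ℝ))
    (μ := MeasureTheory.volume) (a := 0) (b := 1) (l := Filter.atTop) (fun _ => (1 : ℝ))
    (Filter.Eventually.of_forall fun k =>
      (measurable_dLCfin_bigList (Γ k) (Δ k)).aestronglyMeasurable)
    (Filter.Eventually.of_forall fun k => Filter.Eventually.of_forall fun t _ => by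
      rw [Real.norm_of_nonneg (dLCfin_nonneg _ _)]
      exact dLCfin_le_one _ _)
    intervalIntegrable_const ?_
  · rwa [intervalIntegral.integral_zero] at this
  filter_upwards [hE.ae_notMem MeasureTheory.volume] with t htE ht
  rw [uIoc_of_le zero_le_one] at ht
  rw [Metric.tendsto_nhds]
  intro ε hε
  filter_upwards [h t ht.1 htE (ε / 2) (half_pos hε)] with k hk
  rw [dist_zero_right, Real.norm_of_nonneg (dLCfin_nonneg _ _)]
  linarith [dLCfin_le_of_matching hk]

lemma exists_pos_le_abs_loopDiam_sub {t : ℝ} {A : Multiset PLoop}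
    (hA : ∀ a ∈ A, loopDiam a ≠ t) : ∃ δ > 0, ∀ a ∈ A, δ ≤ |loopDiam a - t| := by
  induction A using Multiset.induction with
  | empty => exact ⟨1, one_pos, by simp⟩
  | cons a A ih =>
    obtain ⟨δ, hδ, h⟩ := ih fun b hb => hA b (Multiset.mem_cons_of_mem hb)
    have ha := abs_pos.2 (sub_ne_zero.2 (hA a (Multiset.mem_cons_self a A)))
    refine ⟨min δ |loopDiam a - t|, lt_min hδ ha, fun b hb => ?_⟩
    rcases Multiset.mem_cons.1 hb with rfl | hb
    · exact min_le_right _ _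
    · exact (min_le_left _ _).trans (h b hb)

open scoped Classical in
lemma Matching.filter_loopDiam {A B : Multiset PLoop} {r t : ℝ} (h : Matching A B r)
    (hB : ∀ b ∈ B, 2 * r < |loopDiam b - t|) :
    Matching (A.filter (t < loopDiam ·)) (B.filter (t < loopDiam ·)) r := by
  refine h.filter fun a _ b hb hab => ?_
  have h₁ := hB b hb
  have h₂ := abs_le.1 (PLoop.abs_loopDiam_sub_le a b)
  rcases lt_abs.1 h₁ with h₁ | h₁
  · exact ⟨fun _ => by linarith, fun _ => by linarith⟩
  · exact ⟨fun _ => by linarith, fun _ => by linarith⟩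

section seqOf

variable {ι : Type*} [Encodable ι]

/-- The configuration enumerating a countable family of loops. -/
def seqOf (W : ι → PLoop) (n : ℕ) : Option PLoop := (Encodable.decode₂ ι n).map W

lemma seqOf_eq_some {W : ι → PLoop} {n : ℕ} {γ : PLoop} :
    seqOf W n = some γ ↔ ∃ i, Encodable.encode i = n ∧ W i = γ := by
  simp only [seqOf, Option.map_eq_some_iff, Encodable.decode₂_eq_some]

lemma finite_seqOf {W : ι → PLoop} {t : ℝ} (h : {i | t < loopDiam (W i)}.Finite) :
    {n : ℕ | ∃ γ, seqOf W n = some γ ∧ t < loopDiam γ}.Finite := by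
  refine (h.image Encodable.encode).subset ?_
  rintro n ⟨γ, hs, hd⟩
  obtain ⟨i, rfl, rfl⟩ := seqOf_eq_some.1 hs
  exact ⟨i, hd, rfl⟩

lemma coe_bigList_seqOf {W : ι → PLoop} {t : ℝ} {F : Finset ι}
    (hF : ∀ i, i ∈ F ↔ t < loopDiam (W i)) :
    (bigList (seqOf W) t : Multiset PLoop) = F.val.map W := by
  have hfin : {i | t < loopDiam (W i)}.Finite :=
    F.finite_toSet.subset fun i hi => (hF i).2 hi
  have : bigIdx (seqOf W) t = F.map ⟨Encodable.encode, Encodable.encode_injective⟩ := by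
    ext n
    rw [mem_bigIdx (finite_seqOf hfin), Finset.mem_map]
    constructor
    · rintro ⟨γ, hs, hd⟩
      obtain ⟨i, rfl, rfl⟩ := seqOf_eq_some.1 hs
      exact ⟨i, (hF i).2 hd, rfl⟩
    · rintro ⟨i, hi, rfl⟩
      exact ⟨W i, seqOf_eq_some.2 ⟨i, rfl, rfl⟩, (hF i).1 hi⟩
  rw [coe_bigList, this, Finset.map_val, Multiset.map_map]
  refine Multiset.map_congr rfl fun i _ => ?_
  have : seqOf W (Encodable.encode i) = some (W i) := seqOf_eq_some.2 ⟨i, rfl, rfl⟩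
  simp [this]

lemma isConfig_seqOf {D : Set ℂ} {W : ι → PLoop} (hD : ∀ i, range (W i) ⊆ closure D)
    (h : ∀ t > 0, {i | t < loopDiam (W i)}.Finite) : IsConfig D (seqOf W) := by
  refine ⟨fun n γ hs => ?_, fun t ht A _ _ => (finite_seqOf (h t ht)).subset ?_⟩
  · obtain ⟨i, -, rfl⟩ := seqOf_eq_some.1 hs
    exact hD i
  · rintro n ⟨γ, hs, hd, -⟩
    exact ⟨γ, hs, hd⟩

end seqOf

lemma IsConfig.finite {D : Set ℂ} (hcomp : IsCompact (closure D)) {s : ℕ → Option PLoop}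
    (hs : IsConfig D s) {t : ℝ} (ht : 0 < t) :
    {n : ℕ | ∃ γ, s n = some γ ∧ t < loopDiam γ}.Finite := by
  refine (hs.2 t ht _ hcomp Subset.rfl).subset ?_
  rintro n ⟨γ, h, hd⟩
  exact ⟨γ, h, hd, γ 0, ⟨0, rfl⟩, hs.1 n γ h ⟨0, rfl⟩⟩

lemma countable_setOf_loopDiam (s : ℕ → Option PLoop) :
    {t : ℝ | ∃ n γ, s n = some γ ∧ loopDiam γ = t}.Countable := by
  refine (countable_range fun n => loopDiam ((s n).getD default)).mono ?_
  rintro _ ⟨n, γ, hs, rfl⟩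
  exact ⟨n, by simp [hs]⟩

lemma ae_summable_dLCfin {G : ℕ → ℕ → Option PLoop}
    (hG : ∀ k, dLCseq (G k) (G (k + 1)) ≤ (1 / 2) ^ k) :
    ∀ᵐ t, t ∈ Ioc (0 : ℝ) 1 → Summable fun k => dLCfin (bigList (G k) t) (bigList (G (k + 1)) t) := by
  rw [← MeasureTheory.ae_restrict_iff' measurableSet_Ioc]
  have hmeas : ∀ k, Measurable fun t =>
      ENNReal.ofReal (dLCfin (bigList (G k) t) (bigList (G (k + 1)) t)) := fun k =>
    (measurable_dLCfin_bigList _ _).ennreal_ofReal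
  have hint : ∀ k, ∫⁻ t in Ioc (0 : ℝ) 1,
      ENNReal.ofReal (dLCfin (bigList (G k) t) (bigList (G (k + 1)) t)) ≤
        ENNReal.ofReal ((1 / 2) ^ k) := fun k => by
    rw [← MeasureTheory.ofReal_integral_eq_lintegral_ofReal
      (intervalIntegrable_dLCfin_bigList _ _).1
      (Filter.Eventually.of_forall fun t => dLCfin_nonneg _ _)]
    refine ENNReal.ofReal_le_ofReal (le_trans (le_of_eq ?_) (hG k))
    exact (intervalIntegral.integral_of_le zero_le_one).symm
  have hfin : ∫⁻ t in Ioc (0 : ℝ) 1,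
      ∑' k, ENNReal.ofReal (dLCfin (bigList (G k) t) (bigList (G (k + 1)) t)) ≠ ⊤ := by
    rw [MeasureTheory.lintegral_tsum fun k => (hmeas k).aemeasurable]
    refine ne_top_of_le_ne_top ?_ (ENNReal.tsum_le_tsum hint)
    exact summable_geometric_two.tsum_ofReal_ne_top
  filter_upwards [MeasureTheory.ae_lt_top (Measurable.tsum hmeas) hfin] with t ht
  refine (ENNReal.summable_toReal ht.ne).congr fun k => ?_
  rw [ENNReal.toReal_ofReal (dLCfin_nonneg _ _)]

lemma Finset.val_map_eq_sum {β γ : Type*} (s : Finset β) (f : β → γ) :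
    s.val.map f = ∑ b ∈ s, {f b} := by
  rw [Finset.sum, ← Multiset.sum_map_singleton (s.val.map f), Multiset.map_map]
  rfl

open scoped Classical in
lemma exists_limit_config {D : Set ℂ} (hcomp : IsCompact (closure D))
    {G : ℕ → ℕ → Option PLoop} (hG : ∀ k, IsConfig D (G k)) {e : ℕ → ℝ} (hpos : ∀ j, 0 < e j)
    (hanti : Antitone e) (hlim : Filter.Tendsto e Filter.atTop (nhds 0))
    (hzero : ∀ k, bigList (G k) (e 0) = [])
    (hsum : ∀ j, Summable fun k => dLCfin (bigList (G k) (e j)) (bigList (G (k + 1)) (e j))) :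
    ∃ L, IsConfig D L ∧ Filter.Tendsto (fun k => dLCseq (G k) L) Filter.atTop (nhds 0) := by
  have hmatch : ∀ j, ∀ᶠ k in Filter.atTop, Matching (bigList (G k) (e j) : Multiset PLoop)
      (bigList (G (k + 1)) (e j)) (dLCfin (bigList (G k) (e j)) (bigList (G (k + 1)) (e j))) :=
    fun j => ((hsum j).tendsto_atTop_zero.eventually_lt_const one_pos).mono
      fun k hk => matching_of_dLCfin_lt hk
  -- the loops of `G k` with diameter in `(e (j + 1), e j]`
  let A : ℕ → ℕ → Multiset PLoop := fun j k =>
    (bigList (G k) (e (j + 1)) : Multiset PLoop).filter fun γ => ¬ e j < loopDiam γ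
  have hA : ∀ j k, A j k + bigList (G k) (e j) = bigList (G k) (e (j + 1)) := fun j k => by
    rw [← filter_bigList ((hG k).finite hcomp (hpos (j + 1))) (hanti j.le_succ), add_comm]
    exact Multiset.filter_add_not _ _
  have hB : ∀ j, ∃ B, ∀ ε > 0, ∀ᶠ k in Filter.atTop, Matching (A j k) B ε := fun j => by
    refine Matching.exists_limit ((hsum (j + 1)).add (hsum j)) ?_
    filter_upwards [hmatch j, hmatch (j + 1)] with k h₁ h₂
    rw [← hA, ← hA] at h₂
    convert h₂.sub h₁ using 1
  choose B hB using hB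
  choose N w hw using fun j => (B j).exists_fin_enum
  have hmem : ∀ j i, w j i ∈ B j := fun j i => by
    rw [← hw]
    exact Multiset.mem_map_of_mem _ (Finset.mem_univ i)
  have hdiam : ∀ j i, loopDiam (w j i) ≤ e j := fun j i =>
    Matching.mem_of_isClosed (PLoop.isClosed_setOf_loopDiam_le (e j)) (hB j)
      (fun k a ha => not_lt.1 (Multiset.mem_filter.1 ha).2) (hmem j i)
  have hran : ∀ j i, range (w j i) ⊆ closure D := fun j i =>
    Matching.mem_of_isClosed (PLoop.isClosed_setOf_range_subset isClosed_closure) (hB j)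
      (fun k a ha => by
        obtain ⟨n, hn, -⟩ := mem_bigList ((hG k).finite hcomp (hpos (j + 1)))
          (Multiset.mem_filter.1 ha).1
        exact (hG k).1 n a hn) (hmem j i)
  let W : (Σ j, Fin (N j)) → PLoop := fun i => w i.1 i.2
  let S : ℕ → Finset (Σ j, Fin (N j)) := fun J => (Finset.range J).sigma fun _ => Finset.univ
  have hS : ∀ {J t}, e J < t → ∀ i, t < loopDiam (W i) → i ∈ S J := fun {J t} hJ i hi => by
    simp only [S, Finset.mem_sigma, Finset.mem_range, Finset.mem_univ, and_true]
    by_contra! hle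
    have h₁ := hanti hle
    have h₂ := hdiam i.1 i.2
    exact absurd hi (not_lt.2 (h₂.trans (h₁.trans hJ.le)))
  have hSW : ∀ J, (S J).val.map W = ∑ j ∈ Finset.range J, B j := fun J => by
    rw [Finset.val_map_eq_sum, Finset.sum_sigma]
    refine Finset.sum_congr rfl fun j _ => ?_
    rw [← hw, Finset.val_map_eq_sum]
  have hpart : ∀ J, ∀ ε > 0, ∀ᶠ k in Filter.atTop,
      Matching (bigList (G k) (e J) : Multiset PLoop) (∑ j ∈ Finset.range J, B j) ε := by
    intro J
    induction J with
    | zero =>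
      refine fun ε hε => Filter.Eventually.of_forall fun k => ?_
      rw [hzero]
      exact (Matching.refl 0).mono hε.le
    | succ J ih =>
      intro ε hε
      filter_upwards [ih (ε / 2) (half_pos hε), hB J (ε / 2) (half_pos hε)] with k h₁ h₂
      rw [← hA, Finset.sum_range_succ, add_comm (∑ j ∈ Finset.range J, B j)]
      simpa using h₂.add h₁
  have hlt : ∀ t > 0, ∃ J, e J < t := fun t ht => (hlim.eventually_lt_const ht).exists
  refine ⟨seqOf W, isConfig_seqOf (fun i => hran i.1 i.2) fun t ht => ?_,
    tendsto_dLCseq (countable_setOf_loopDiam (seqOf W)) fun t ht htE ε hε => ?_⟩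
  · obtain ⟨J, hJ⟩ := hlt t ht
    exact (S J).finite_toSet.subset (hS hJ)
  · obtain ⟨J, hJ⟩ := hlt t ht
    have hL : (bigList (seqOf W) t : Multiset PLoop) =
        (∑ j ∈ Finset.range J, B j).filter (t < loopDiam ·) := by
      rw [coe_bigList_seqOf (F := (S J).filter fun i => t < loopDiam (W i)), ← hSW,
        Multiset.filter_map, ← Finset.filter_val]
      · rfl
      · exact fun i => ⟨fun hi => (Finset.mem_filter.1 hi).2,
          fun hi => Finset.mem_filter.2 ⟨hS hJ i hi, hi⟩⟩
    obtain ⟨δ, hδ, hgap⟩ := exists_pos_le_abs_loopDiam_sub (t := t)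
      (A := ∑ j ∈ Finset.range J, B j) fun b hb hbt => by
        rw [← hSW] at hb
        obtain ⟨i, -, rfl⟩ := Multiset.mem_map.1 hb
        exact htE ⟨_, _, seqOf_eq_some.2 ⟨i, rfl, rfl⟩, hbt⟩
    filter_upwards [hpart J (min ε (δ / 3)) (lt_min hε (by positivity))] with k hk
    rw [hL, ← filter_bigList ((hG k).finite hcomp (hpos J)) hJ.le]
    refine (hk.filter_loopDiam fun b hb => ?_).mono (min_le_left _ _)
    have := hgap b hb
    have := min_le_right ε (δ / 3)
    linarith

lemma exists_limit_of_fast {D : Set ℂ} (hcomp : IsCompact (closure D))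
    {G : ℕ → ℕ → Option PLoop} (hG : ∀ k, IsConfig D (G k))
    (hfast : ∀ k, dLCseq (G k) (G (k + 1)) ≤ (1 / 2) ^ k) :
    ∃ L, IsConfig D L ∧ Filter.Tendsto (fun k => dLCseq (G k) L) Filter.atTop (nhds 0) := by
  have hdense := MeasureTheory.Measure.dense_of_ae (ae_summable_dLCfin hfast)
  have hbetween : ∀ j : ℕ, (1 : ℝ) / (j + 1 + 1) < 1 / (j + 1) := fun j =>
    one_div_lt_one_div_of_lt (by positivity) (by linarith)
  choose c hc hlo hhi using fun j => hdense.exists_between (hbetween j)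
  have hcpos : ∀ j, 0 < c j := fun j => lt_trans (by positivity) (hlo j)
  have hcle : ∀ j, c j ≤ 1 := fun j => (hhi j).le.trans <| by
    rw [div_le_one (by positivity)]
    have : (0 : ℝ) ≤ j := j.cast_nonneg
    linarith
  have hanti : Antitone c := antitone_nat_of_succ_le fun j => by
    have := hhi (j + 1)
    push_cast at this
    exact (this.trans (hlo j)).le
  have hclim : Filter.Tendsto c Filter.atTop (nhds 0) :=
    squeeze_zero (fun j => (hcpos j).le) (fun j => (hhi j).le)
      tendsto_one_div_add_atTop_nhds_zero_nat
  let R : ℝ := max 1 (Metric.diam (closure D))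
  let e : ℕ → ℝ := fun j => Nat.casesOn j R c
  have hzero : ∀ k, bigList (G k) R = [] := fun k => by
    rw [← Multiset.coe_eq_zero]
    refine Multiset.eq_zero_of_forall_notMem fun γ hγ => ?_
    obtain ⟨n, hn, hd⟩ := mem_bigList ((hG k).finite hcomp (lt_max_of_lt_left one_pos)) hγ
    refine absurd hd (not_lt.2 (le_max_of_le_right ?_))
    exact Metric.diam_mono ((hG k).1 n γ hn) hcomp.isBounded
  refine exists_limit_config hcomp hG (e := e) (fun j => ?_) (antitone_nat_of_succ_le fun j => ?_)
    ((Filter.tendsto_add_atTop_iff_nat 1).1 hclim) hzero fun j => ?_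
  · cases j with
    | zero => exact lt_max_of_lt_left one_pos
    | succ j => exact hcpos j
  · cases j with
    | zero => exact le_max_of_le_left (hcle 0)
    | succ j => exact hanti j.le_succ
  · cases j with
    | zero =>
      refine summable_zero.congr fun k => ?_
      change 0 = dLCfin (bigList (G k) R) (bigList (G (k + 1)) R)
      rw [hzero, hzero]
      exact (dLCfin_nonneg _ _).antisymm (dLCfin_le_of_matching (Matching.refl _))
    | succ j => exact hc j ⟨hcpos j, hcle j⟩

lemma exists_tendsto_of_approx {D : Set ℂ} (hcomp : IsCompact (closure D)) {Q : Set PLoop}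
    (hQ : ∀ γ : PLoop, range γ ⊆ closure D → ∀ ε > 0, ∃ q ∈ Q, dist γ q < ε)
    {s : ℕ → Option PLoop} (hs : IsConfig D s) :
    ∃ l : ℕ → List Q, Filter.Tendsto
      (fun k => dLCseq s (seqOf fun i : Fin (l k).length => ((l k).get i : PLoop)))
      Filter.atTop (nhds 0) := by
  classical
  have hfin : ∀ k : ℕ, {n : ℕ | ∃ γ, s n = some γ ∧ 1 / ((k : ℝ) + 1) < loopDiam γ}.Finite :=
    fun k => hs.finite hcomp (by positivity)
  choose l hl using fun k : ℕ => Matching.exists_approx (Q := Q) (r := 1 / ((k : ℝ) + 1))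
    (bigList s (1 / ((k : ℝ) + 1)) : Multiset PLoop)
    (fun γ hγ => by
      obtain ⟨n, hn, -⟩ := mem_bigList (hfin k) hγ
      exact hQ γ (hs.1 n γ hn)) (by positivity)
  refine ⟨l, tendsto_dLCseq (countable_setOf_loopDiam s) fun t ht htE ε hε => ?_⟩
  have hhalf := hs.finite hcomp (half_pos ht)
  obtain ⟨δ, hδ, hgap⟩ := exists_pos_le_abs_loopDiam_sub (t := t)
    (A := (bigList s (t / 2) : Multiset PLoop)) fun γ hγ hγt => by
      obtain ⟨n, hn, -⟩ := mem_bigList hhalf hγ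
      exact htE ⟨n, γ, hn, hγt⟩
  have hsmall : 0 < min ε (min (t / 2) (δ / 3)) / 3 := by positivity
  filter_upwards [tendsto_one_div_add_atTop_nhds_zero_nat.eventually_lt_const hsmall] with k hk
  have h₁ := min_le_left ε (min (t / 2) (δ / 3))
  have h₂ := (min_le_right ε (min (t / 2) (δ / 3))).trans (min_le_left _ _)
  have h₃ := (min_le_right ε (min (t / 2) (δ / 3))).trans (min_le_right _ _)
  have h₀ : (0 : ℝ) < 1 / (k + 1) := by positivity
  rw [← filter_bigList (hfin k) (by linarith)]
  have hL : (bigList (seqOf fun i : Fin (l k).length => ((l k).get i : PLoop)) t :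
      Multiset PLoop) =
      (((l k).map (↑) : List PLoop) : Multiset PLoop).filter (t < loopDiam ·) := by
    have hmap : Finset.univ.val.map (fun i : Fin (l k).length => ((l k).get i : PLoop)) =
        (((l k).map (↑) : List PLoop) : Multiset PLoop) := by
      rw [Fin.univ_val_map]
      congr 1
      conv_rhs => rw [← List.ofFn_get (l k), List.map_ofFn]
      rfl
    rw [coe_bigList_seqOf (F := Finset.univ.filter fun i => t < loopDiam ((l k).get i))
      (fun i => by simp), ← hmap, Multiset.filter_map, ← Finset.filter_val]
    rfl
  rw [hL]
  refine ((hl k).symm.filter_loopDiam fun γ hγ => ?_).symm.mono (by linarith)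
  by_cases hd : t / 2 < loopDiam γ
  · have := hgap γ <| by
      rw [← filter_bigList (hfin k) (by linarith)]
      exact Multiset.mem_filter.2 ⟨hγ, hd⟩
    linarith
  · have := neg_le_abs (loopDiam γ - t)
    linarith

/-- For a domain `D ⊆ ℂ` with `closure D` compact, the metric `𝕕_D^LC` on locally finite
loop configurations on `D` is complete and separable. -/
theorem dLC_complete_and_separable (D : Set ℂ) (hD : IsOpen D) (hDconn : IsConnected D)
    (hcomp : IsCompact (closure D)) :
    (∀ Γ : ℕ → {s : ℕ → Option PLoop // IsConfig D s},
      (∀ ε : ℝ, 0 < ε → ∃ M : ℕ, ∀ m ≥ M, ∀ n ≥ M, dLCseq (Γ m).1 (Γ n).1 < ε) →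
      ∃ L : {s : ℕ → Option PLoop // IsConfig D s},
        Filter.Tendsto (fun n => dLCseq (Γ n).1 L.1) Filter.atTop (nhds 0)) ∧
    (∃ S : Set {s : ℕ → Option PLoop // IsConfig D s}, S.Countable ∧
      ∀ Γ : {s : ℕ → Option PLoop // IsConfig D s}, ∀ ε : ℝ, 0 < ε →
        ∃ Γ' ∈ S, dLCseq Γ.1 Γ'.1 < ε) := by
  refine ⟨fun Γ hΓ => ?_, ?_⟩
  · obtain ⟨φ, hmono, hφ⟩ := Filter.extraction_forall_of_eventually'
      (P := fun k n => ∀ m ≥ n, dLCseq (Γ n).1 (Γ m).1 < (1 / 2) ^ k) fun k => by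
        obtain ⟨M, hM⟩ := hΓ ((1 / 2) ^ k) (by positivity)
        exact ⟨M, fun n hn m hm => hM n hn m (hn.trans hm)⟩
    obtain ⟨L, hL, hlim⟩ := exists_limit_of_fast hcomp (fun k => (Γ (φ k)).2)
      fun k => (hφ k _ (hmono k.lt_succ_self).le).le
    refine ⟨⟨L, hL⟩, Metric.tendsto_atTop.2 fun ε hε => ?_⟩
    obtain ⟨M, hM⟩ := hΓ (ε / 2) (half_pos hε)
    obtain ⟨k, hk, hMk⟩ := ((hlim.eventually_lt_const (half_pos hε)).and
      (hmono.tendsto_atTop.eventually_ge_atTop M)).exists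
    refine ⟨M, fun n hn => ?_⟩
    rw [dist_zero_right, Real.norm_of_nonneg (dLCseq_nonneg _ _)]
    linarith [dLCseq_triangle (Γ n).1 (Γ (φ k)).1 L, hM n hn (φ k) hMk]
  · obtain ⟨Q, hQD, hQ, hdense⟩ :=
      PLoop.exists_countable_approx {γ : PLoop | range γ ⊆ closure D}
    have : Countable Q := hQ.to_subtype
    let f : List Q → {s : ℕ → Option PLoop // IsConfig D s} := fun l =>
      ⟨seqOf fun i : Fin l.length => (l.get i : PLoop),
        isConfig_seqOf (fun i => hQD (l.get i).2) fun _ _ => toFinite _⟩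
    refine ⟨range f, countable_range f, fun Γ ε hε => ?_⟩
    obtain ⟨l, hl⟩ := exists_tendsto_of_approx hcomp hdense Γ.2
    obtain ⟨k, hk⟩ := (hl.eventually_lt_const hε).exists
    exact ⟨f (l k), mem_range_self _, hk⟩
end
end

section
/- Let $\{\mathcal{A}_n\}$ and $\{\hat{\mathcal{A}}_n\}$ be sequences of annular subdomains of $\mathbb{D}$, each pair conformally equivalent to an annulus of the same modulus, each with outer boundary $\partial\mathbb{D}$. Suppose for each $n$ there exist $C_n>1$ and $\delta_n\in(0,1)$ with $\mathbb{D}\setminus B_{C_n\delta_n}(0)\subset\mathcal{A}_n\subset\mathbb{D}\setminus B_{\delta_n/C_n}(0)$, $\delta_n\to 0$, and $C_n=o(\delta_n^{-1})$, and similarly for $\hat{\mathcal{A}}_n$. Let $f_n:\mathcal{A}_n\to\hat{\mathcal{A}}_n$ be the conformal map taking inner boundary to inner boundary and outer to outer, normalized so that $f_n(1)=1$. Then $f_n$ converges uniformly to the identity map on $\overline{\mathbb{D}}\setminus\{0\}$, at a rate depending only on $\delta_n$ and $C_n$. -/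
noncomputable section

section Helpers

open Complex Metric Set Filter Topology
open scoped ComplexConjugate

/-- A continuous function that is holomorphic off the imaginary axis is holomorphic. -/
lemma differentiableOn_of_continuousOn_of_re_ne_zero {U : Set ℂ} {f : ℂ → ℂ} (hU : IsOpen U)
    (hc : ContinuousOn f U) (hd : ∀ z ∈ U, z.re ≠ 0 → DifferentiableAt ℂ f z) :
    DifferentiableOn ℂ f U := by
  refine (isConservativeOn_and_continuousOn_iff_isDifferentiableOn hU).1 ⟨?_, hc⟩
  have half : ∀ z w : ℂ, Rectangle z w ⊆ U → (0 ≤ z.re ∧ 0 ≤ w.re ∨ z.re ≤ 0 ∧ w.re ≤ 0) →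
      (∫ x : ℝ in z.re..w.re, f (x + z.im * I)) - (∫ x : ℝ in z.re..w.re, f (x + w.im * I)) +
      I • (∫ y : ℝ in z.im..w.im, f (w.re + y * I)) -
      I • (∫ y : ℝ in z.im..w.im, f (z.re + y * I)) = 0 := by
    intro z w hzw hs
    refine integral_boundary_rect_eq_zero_of_continuousOn_of_differentiableOn f z w
      (hc.mono hzw) fun x hx ↦ (hd x (hzw ⟨Ioo_subset_Icc_self hx.1, Ioo_subset_Icc_self hx.2⟩)
        ?_).differentiableWithinAt
    have h1 := hx.1.1
    have h2 := hx.1.2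
    rcases hs with hs | hs
    · exact ((le_min hs.1 hs.2).trans_lt h1).ne'
    · exact (h2.trans_le (max_le hs.1 hs.2)).ne
  intro z w hzw
  rw [← add_eq_zero_iff_eq_neg, wedgeIntegral_add_wedgeIntegral_eq]
  by_cases hs : 0 ≤ z.re ∧ 0 ≤ w.re ∨ z.re ≤ 0 ∧ w.re ≤ 0
  · exact half z w hzw hs
  have h0 : (0 : ℝ) ∈ uIcc z.re w.re := by
    rw [mem_uIcc]
    rcases le_total 0 z.re with h | h <;> rcases le_total 0 w.re with h' | h' <;> grind
  have hsub : ∀ a b : ℝ, a ∈ uIcc z.re w.re → b ∈ uIcc z.im w.im → (a + b * I : ℂ) ∈ U := by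
    intro a b ha hb
    exact hzw ⟨by simpa using ha, by simpa using hb⟩
  have hii : ∀ a a' b : ℝ, a ∈ uIcc z.re w.re → a' ∈ uIcc z.re w.re → b ∈ uIcc z.im w.im →
      IntervalIntegrable (fun x : ℝ ↦ f (x + b * I)) MeasureTheory.volume a a' := by
    intro a a' b ha ha' hb
    refine ContinuousOn.intervalIntegrable (hc.comp (by fun_prop) fun x hx ↦ ?_)
    exact hsub x b (uIcc_subset_uIcc ha ha' hx) hb
  have e1 := half z ⟨0, w.im⟩ (fun x hx ↦ hzw ⟨uIcc_subset_uIcc left_mem_uIcc h0 hx.1, hx.2⟩)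
    (by rcases le_total 0 z.re with h | h <;> simp [h])
  have e2 := half ⟨0, z.im⟩ w (fun x hx ↦ hzw ⟨uIcc_subset_uIcc h0 right_mem_uIcc hx.1, hx.2⟩)
    (by rcases le_total 0 w.re with h | h <;> simp [h])
  have s1 := intervalIntegral.integral_add_adjacent_intervals
    (hii z.re 0 z.im left_mem_uIcc h0 left_mem_uIcc) (hii 0 w.re z.im h0 right_mem_uIcc left_mem_uIcc)
  have s2 := intervalIntegral.integral_add_adjacent_intervals
    (hii z.re 0 w.im left_mem_uIcc h0 right_mem_uIcc)
    (hii 0 w.re w.im h0 right_mem_uIcc right_mem_uIcc)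
  rw [← s1, ← s2]
  simp only at e1 e2
  linear_combination e1 + e2

/-- A zero-free holomorphic function on a disc has a holomorphic logarithm. -/
lemma exists_differentiableOn_log {G : ℂ → ℂ} {R : ℝ} (hR : 0 < R)
    (hG : DifferentiableOn ℂ G (ball 0 R)) (h0 : ∀ z ∈ ball (0 : ℂ) R, G z ≠ 0) (h1 : G 0 = 1) :
    ∃ φ : ℂ → ℂ, DifferentiableOn ℂ φ (ball 0 R) ∧ φ 0 = 0 ∧
      ∀ z ∈ ball (0 : ℂ) R, exp (φ z) = G z := by
  obtain ⟨φ, hφ0, hφ⟩ := ((hG.deriv isOpen_ball).div hG h0).isExactOn_ball.with_val_at 0 0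
  refine ⟨φ, fun z hz ↦ (hφ z hz).differentiableAt.differentiableWithinAt, hφ0, fun z hz ↦ ?_⟩
  have hder : ∀ w ∈ ball (0 : ℂ) R, HasDerivAt (fun z ↦ G z * exp (-φ z)) 0 w := by
    intro w hw
    have := ((hG.differentiableAt (isOpen_ball.mem_nhds hw)).hasDerivAt).mul ((hφ w hw).neg.cexp)
    refine this.congr_deriv ?_
    simp only [Pi.div_apply]
    field_simp [h0 w hw]
    ring
  have := (convex_ball (0 : ℂ) R).is_const_of_fderivWithin_eq_zero (𝕜 := ℂ)
    (fun w hw ↦ (hder w hw).differentiableAt.differentiableWithinAt)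
    (fun w hw ↦ by
      rw [fderivWithin_of_isOpen isOpen_ball hw]
      ext; simp [(hder w hw).deriv]) hz (mem_ball_self hR)
  simp only [hφ0, h1, neg_zero, exp_zero, mul_one] at this
  rw [exp_neg, mul_inv_eq_one₀ (exp_ne_zero _)] at this
  exact this.symm

/-- The Rogosinski transform of a holomorphic function `φ` whose real part has the sign of the real
part of the variable. -/
def rogosinski (φ : ℂ → ℂ) (ρ : ℝ) (z : ℂ) : ℂ := (1 + z ^ 2 / ρ ^ 2) * dslope φ 0 z

lemma rogosinski_zero (φ : ℂ → ℂ) (ρ : ℝ) : rogosinski φ ρ 0 = deriv φ 0 := by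
  simp [rogosinski]

lemma mul_rogosinski {φ : ℂ → ℂ} (h0 : φ 0 = 0) (ρ : ℝ) (z : ℂ) :
    z * rogosinski φ ρ z = (1 + z ^ 2 / ρ ^ 2) * φ z := by
  have := sub_smul_dslope φ 0 z
  simp only [sub_zero, smul_eq_mul, h0] at this
  rw [rogosinski, ← this]; ring

lemma differentiableOn_rogosinski {φ : ℂ → ℂ} {R : ℝ} (hR : 0 < R) (ρ : ℝ)
    (hφ : DifferentiableOn ℂ φ (ball 0 R)) : DifferentiableOn ℂ (rogosinski φ ρ) (ball 0 R) := by
  have := (differentiableOn_dslope (ball_mem_nhds (0 : ℂ) hR)).2 hφ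
  unfold rogosinski
  fun_prop

lemma rogosinski_re_nonneg {φ : ℂ → ℂ} {R ρ : ℝ} (hρ : 0 < ρ) (hρR : ρ < R)
    (hφ : DifferentiableOn ℂ φ (ball 0 R)) (h0 : φ 0 = 0)
    (hs : ∀ z ∈ ball (0 : ℂ) R, 0 ≤ z.re * (φ z).re) {z : ℂ} (hz : z ∈ ball (0 : ℂ) ρ) :
    0 ≤ (rogosinski φ ρ z).re := by
  have hd := differentiableOn_rogosinski (hρ.trans hρR) ρ hφ
  have hcl : closure (ball (0 : ℂ) ρ) ⊆ ball 0 R := by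
    rw [closure_ball _ hρ.ne']; exact closedBall_subset_ball hρR
  have hdc : DiffContOnCl ℂ (fun z ↦ exp (-rogosinski φ ρ z)) (ball 0 ρ) :=
    (hd.mono hcl).neg.cexp.diffContOnCl
  have key := Complex.norm_le_of_forall_mem_frontier_norm_le isBounded_ball hdc (C := 1) ?_
    (subset_closure hz)
  · rw [norm_exp, Real.exp_le_one_iff, neg_re] at key; linarith
  intro w hw
  rw [frontier_ball _ hρ.ne', mem_sphere_zero_iff_norm] at hw
  rw [norm_exp, Real.exp_le_one_iff, neg_re, neg_nonpos]
  have hw0 : w ≠ 0 := by rintro rfl; simp at hw; exact hρ.ne hw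
  have hw2 : w * conj w = (ρ : ℂ) ^ 2 := by rw [mul_conj, normSq_eq_norm_sq, hw]; simp
  have hρ0 : (ρ : ℂ) ≠ 0 := by exact_mod_cast hρ.ne'
  have : rogosinski φ ρ w = ((2 * w.re / ρ ^ 2 : ℝ) : ℂ) * φ w := by
    refine mul_left_cancel₀ hw0 ?_
    rw [mul_rogosinski h0]
    have h2 : w + conj w = ((2 * w.re : ℝ) : ℂ) := add_conj w
    have e : (1 + w ^ 2 / (ρ : ℂ) ^ 2) = w * ((2 * w.re / ρ ^ 2 : ℝ) : ℂ) := by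
      push_cast at h2 ⊢
      field_simp
      linear_combination w * h2 - hw2
    rw [e]; ring
  rw [this, re_ofReal_mul]
  have := hs w (by simpa [hw] using hρR)
  have e : 2 * w.re / ρ ^ 2 * (φ w).re = 2 / ρ ^ 2 * (w.re * (φ w).re) := by ring
  rw [e]; positivity

lemma norm_rogosinski_sub_le {φ : ℂ → ℂ} {R ρ M : ℝ} (hρ : 0 < ρ) (hρR : ρ < R)
    (hφ : DifferentiableOn ℂ φ (ball 0 R)) (h0 : φ 0 = 0)
    (hs : ∀ z ∈ ball (0 : ℂ) R, 0 ≤ z.re * (φ z).re) (hM : 0 < M) (hcM : (deriv φ 0).re ≤ M)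
    {z : ℂ} (hz : z ∈ ball (0 : ℂ) ρ) :
    ‖rogosinski φ ρ z - deriv φ 0‖ ≤ 2 * M * ‖z‖ / (ρ - ‖z‖) := by
  have hd := (differentiableOn_rogosinski (hρ.trans hρR) ρ hφ).mono (ball_subset_ball hρR.le)
  rw [norm_sub_rev]
  refine borelCaratheodory_zero (f := fun z ↦ deriv φ 0 - rogosinski φ ρ z) hM (by fun_prop)
    (fun w hw ↦ ?_) hρ hz (by simp [rogosinski_zero])
  have := rogosinski_re_nonneg hρ hρR hφ h0 hs hw
  simp only [mem_ofPred_eq, sub_re]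
  linarith
/-- If `φ` maps the left half of a disc to the left half-plane, fixes the imaginary axis and
`exp ∘ φ` is injective modulo the periods of `exp` on the left half, then `φ` winds at most once. -/
lemma winding_le_one {φ : ℂ → ℂ} {R : ℝ} {k : ℤ} (hR : 2 * Real.pi < R)
    (hφ : DifferentiableOn ℂ φ (ball 0 R)) (h0 : φ 0 = 0)
    (hneg : ∀ z ∈ ball (0 : ℂ) R, z.re < 0 → (φ z).re < 0)
    (hnn : ∀ z ∈ ball (0 : ℂ) R, 0 ≤ z.re → 0 ≤ (φ z).re)
    (hax : ∀ z ∈ ball (0 : ℂ) R, z.re = 0 → (φ z).re = 0)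
    (hk : φ (2 * Real.pi * I) = 2 * Real.pi * I * k)
    (hinj : ∀ z ∈ ball (0 : ℂ) R, ∀ w ∈ ball (0 : ℂ) R, z.re < 0 → w.re < 0 →
      exp (φ z) = exp (φ w) → exp z = exp w) : k ≤ 1 := by
  by_contra! hk1
  have hpi := Real.pi_pos
  have hmem : ∀ y ∈ Icc 0 (2 * Real.pi), (y * I : ℂ) ∈ ball (0 : ℂ) R := by
    intro y hy
    simpa [abs_of_nonneg hy.1] using hy.2.trans_lt hR
  have hcont : ContinuousOn (fun y : ℝ ↦ (φ (y * I)).im) (Icc 0 (2 * Real.pi)) :=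
    continuous_im.comp_continuousOn (hφ.continuousOn.comp (by fun_prop) hmem)
  have hk' : (2 : ℝ) ≤ k := by exact_mod_cast hk1
  obtain ⟨y, hy, hyφ⟩ := intermediate_value_Ioo (by positivity) hcont
    (show 2 * Real.pi ∈ Ioo _ _ by
      constructor
      · simp [h0, hpi]
      · simp only [ofReal_mul, ofReal_ofNat, hk]
        simp
        nlinarith)
  have hyb := hmem y (Ioo_subset_Icc_self hy)
  have hφy : φ (y * I) = 2 * Real.pi * I := by
    apply Complex.ext
    · rw [hax _ hyb (by simp)]; simp
    · simpa using hyφ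
  have hopen : ∀ z ∈ ball (0 : ℂ) R, z.re = 0 → 𝓝 (φ z) ≤ map φ (𝓝 z) := by
    intro z hz hzre
    refine ((hφ.analyticAt (isOpen_ball.mem_nhds hz)).eventually_constant_or_nhds_le_map_nhds
      ).resolve_left fun hcst ↦ ?_
    have ht : Tendsto (fun t : ℝ ↦ z - t) (𝓝[>] 0) (𝓝 z) := by
      have : Continuous (fun t : ℝ ↦ z - t) := by fun_prop
      simpa using (this.tendsto 0).mono_left nhdsWithin_le_nhds
    obtain ⟨t, ht1, ht2, ht3⟩ := ((ht.eventually hcst).and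
      ((ht.eventually (isOpen_ball.mem_nhds hz)).and self_mem_nhdsWithin)).exists
    have := hneg _ ht2 (by simpa [hzre] using ht3)
    rw [ht1, hax z hz hzre] at this
    exact lt_irrefl _ this
  set η := min y (2 * Real.pi - y) / 2 with hη
  have hη1 : 2 * η ≤ y := by rw [hη]; linarith [min_le_left y (2 * Real.pi - y)]
  have hη2 : 2 * η ≤ 2 * Real.pi - y := by rw [hη]; linarith [min_le_right y (2 * Real.pi - y)]
  have hη0 : 0 < η := by
    have : 0 < min y (2 * Real.pi - y) := lt_min hy.1 (by linarith [hy.2])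
    positivity
  have hR0 : (0 : ℂ) ∈ ball (0 : ℂ) R := mem_ball_self (by linarith)
  have hV : ∀ a : ℝ, (a * I : ℂ) ∈ ball (0 : ℂ) R →
      φ '' (ball (0 : ℂ) R ∩ {z | |z.im - a| < η}) ∈ 𝓝 (φ (a * I)) := by
    intro a ha
    refine hopen _ ha (by simp) (image_mem_map (inter_mem (isOpen_ball.mem_nhds ha) ?_))
    have : IsOpen {z : ℂ | |z.im - a| < η} :=
      isOpen_lt (by fun_prop) continuous_const
    exact this.mem_nhds (by simpa using hη0)
  have hV0 := hV 0 (by simpa using hR0)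
  have hVy := hV y hyb
  rw [hφy] at hVy
  simp only [ofReal_zero, zero_mul, h0] at hV0
  have t0 : Tendsto (fun t : ℝ ↦ (-t : ℂ)) (𝓝[>] 0) (𝓝 0) := by
    have : Continuous (fun t : ℝ ↦ (-t : ℂ)) := by fun_prop
    simpa using (this.tendsto 0).mono_left nhdsWithin_le_nhds
  have ty : Tendsto (fun t : ℝ ↦ 2 * Real.pi * I + (-t : ℂ)) (𝓝[>] 0) (𝓝 (2 * Real.pi * I)) := by
    simpa using t0.const_add (2 * Real.pi * I : ℂ)
  obtain ⟨t, ⟨z, ⟨hz, hz'⟩, hzt⟩, ⟨w, ⟨hw, hw'⟩, hwt⟩, htpos⟩ :=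
    ((t0.eventually hV0).and ((ty.eventually hVy).and self_mem_nhdsWithin)).exists
  have htpos : 0 < t := htpos
  have hzre : z.re < 0 := by
    by_contra! h
    have := hnn z hz h
    rw [hzt] at this; simp at this; linarith
  have hwre : w.re < 0 := by
    by_contra! h
    have := hnn w hw h
    rw [hwt] at this; simp at this; linarith
  have he := hinj z hz w hw hzre hwre (by
    rw [hzt, hwt, exp_add, exp_two_pi_mul_I, one_mul])
  obtain ⟨n, hn⟩ := exp_eq_exp_iff_exists_int.1 he
  have him : z.im = w.im + n * (2 * Real.pi) := by rw [hn]; simp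
  have hz'' := abs_lt.1 (show |z.im - 0| < η from hz')
  have hw'' := abs_lt.1 (show |w.im - y| < η from hw')
  have hn1 : (-1 : ℝ) < n := by nlinarith
  have hn2 : (n : ℝ) < 0 := by nlinarith
  have hn1 : -1 < n := by exact_mod_cast hn1
  have hn2 : n < 0 := by exact_mod_cast hn2
  omega

/-- Under the hypotheses of `winding_le_one`, the map `φ` is close to the identity on compact sets. -/
lemma norm_sub_self_le {φ : ℂ → ℂ} {R ρ N : ℝ} {k : ℤ} (hN : 2 * Real.pi ≤ N)
    (hNρ : 10 * N ≤ ρ) (hρR : ρ < R)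
    (hφ : DifferentiableOn ℂ φ (ball 0 R)) (h0 : φ 0 = 0)
    (hneg : ∀ z ∈ ball (0 : ℂ) R, z.re < 0 → (φ z).re < 0)
    (hnn : ∀ z ∈ ball (0 : ℂ) R, 0 ≤ z.re → 0 ≤ (φ z).re)
    (hax : ∀ z ∈ ball (0 : ℂ) R, z.re = 0 → (φ z).re = 0)
    (hk : φ (2 * Real.pi * I) = 2 * Real.pi * I * k)
    (hinj : ∀ z ∈ ball (0 : ℂ) R, ∀ w ∈ ball (0 : ℂ) R, z.re < 0 → w.re < 0 →
      exp (φ z) = exp (φ w) → exp z = exp w) {z : ℂ} (hz : ‖z‖ ≤ N) :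
    ‖φ z - z‖ ≤ 7 * N ^ 2 / ρ := by
  have hpi := Real.pi_gt_three
  have hρ : 0 < ρ := by linarith
  have hρC : (ρ : ℂ) ≠ 0 := by exact_mod_cast hρ.ne'
  have hs : ∀ z ∈ ball (0 : ℂ) R, 0 ≤ z.re * (φ z).re := by
    intro z hz
    rcases lt_or_ge z.re 0 with h | h
    · exact mul_nonneg_of_nonpos_of_nonpos h.le (hneg z hz h).le
    · exact mul_nonneg h (hnn z hz h)
  set c := deriv φ 0 with hc
  have hbd : ∀ M : ℝ, 0 < M → c.re ≤ M → ∀ z ∈ ball (0 : ℂ) ρ,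
      ‖rogosinski φ ρ z - c‖ ≤ 2 * M * ‖z‖ / (ρ - ‖z‖) := fun M hM hcM z hz ↦
    norm_rogosinski_sub_le hρ hρR hφ h0 hs hM hcM hz
  have hcpos : 0 < c.re := by
    by_contra! hcn
    have hm1 : (-1 : ℂ) ∈ ball (0 : ℂ) ρ := by simp; linarith
    have heq : rogosinski φ ρ (-1) = c := by
      rw [← sub_eq_zero, ← norm_le_zero_iff]
      refine le_of_forall_pos_le_add fun e he ↦ ?_
      have := hbd e he (hcn.trans he.le) _ hm1
      refine this.trans ?_
      rw [norm_neg, norm_one, div_le_iff₀ (by linarith)]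
      nlinarith
    have h2 := mul_rogosinski h0 ρ (-1)
    have e : (1 + (-1 : ℂ) ^ 2 / ρ ^ 2) = ((1 + 1 / ρ ^ 2 : ℝ) : ℂ) := by push_cast; ring
    rw [heq, e] at h2
    have h3 := congrArg re h2
    rw [re_ofReal_mul] at h3
    simp only [neg_mul, one_mul, neg_re] at h3
    have h4 := hneg (-1) (ball_subset_ball hρR.le hm1) (by simp)
    have h5 : 0 < 1 + 1 / ρ ^ 2 := by positivity
    nlinarith
  set t := N / ρ with ht
  have ht0 : 0 ≤ t := div_nonneg (by linarith) hρ.le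
  have ht1 : t ≤ 1 / 10 := by rw [ht, div_le_iff₀ hρ]; linarith
  have hNt : N = t * ρ := by rw [ht]; field_simp
  have hbd' : ∀ z : ℂ, ‖z‖ ≤ N → ‖rogosinski φ ρ z - c‖ ≤ 9 / 4 * c.re * t := by
    intro z hz
    refine (hbd c.re hcpos le_rfl z (by simp; linarith)).trans ?_
    rw [div_le_iff₀ (by linarith)]
    have h1 : 2 * c.re * ‖z‖ ≤ 2 * c.re * N := by gcongr
    have h2 : 9 / 4 * c.re * t * (ρ - N) ≤ 9 / 4 * c.re * t * (ρ - ‖z‖) := by gcongr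
    have h3 : 0 ≤ c.re * t * ρ := by positivity
    rw [hNt] at h1 h2
    nlinarith
  set s := (2 * Real.pi / ρ) ^ 2 with hsdef
  have hs0 : 0 ≤ s := by positivity
  have hst : s ≤ t ^ 2 := by
    rw [hsdef, ht]; gcongr
  have htsq : t ^ 2 ≤ t / 10 := by nlinarith
  have hP : rogosinski φ ρ (2 * Real.pi * I) = ((k * (1 - s) : ℝ) : ℂ) := by
    have h2 := mul_rogosinski h0 ρ (2 * Real.pi * I)
    rw [hk] at h2
    refine mul_left_cancel₀ two_pi_I_ne_zero (h2.trans ?_)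
    rw [hsdef]
    push_cast
    rw [mul_pow _ I, I_sq]
    ring
  have hn2 : ‖(2 * Real.pi * I : ℂ)‖ ≤ N := by
    simpa [abs_of_pos Real.pi_pos] using hN
  have hb2 := hbd' _ hn2
  rw [hP] at hb2
  have hre := abs_le.1 ((abs_re_le_norm _).trans hb2)
  rw [sub_re, ofReal_re] at hre
  have hct : c.re * t ≤ c.re / 10 := by nlinarith
  have hk0 : 0 < k := by
    have : 0 < (k : ℝ) * (1 - s) := by nlinarith
    have := pos_of_mul_pos_left this (by nlinarith)
    exact_mod_cast this
  have hk1 := winding_le_one (by linarith) hφ h0 hneg hnn hax hk hinj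
  obtain rfl : k = 1 := by omega
  have hc2 : c.re ≤ 4 / 3 := by norm_num at hre; nlinarith
  have hb3 : ∀ z : ℂ, ‖z‖ ≤ N → ‖rogosinski φ ρ z - c‖ ≤ 3 * t := by
    intro z hz
    refine (hbd' z hz).trans ?_
    nlinarith
  have hc1 : ‖c - 1‖ ≤ 3 * t + s := by
    have e : c - 1 = -((((1 : ℤ) * (1 - s) : ℝ) : ℂ) - c) - s := by push_cast; ring
    rw [e]
    refine (norm_sub_le _ _).trans ?_
    rw [norm_neg, ← hP, norm_real, Real.norm_of_nonneg hs0]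
    gcongr
    exact hb3 _ hn2
  have hzρ : ‖z ^ 2 / (ρ : ℂ) ^ 2‖ ≤ t ^ 2 := by
    rw [norm_div, norm_pow, norm_pow, norm_real, Real.norm_of_nonneg hρ.le, ← div_pow, ht]
    gcongr
  set q := z ^ 2 / (ρ : ℂ) ^ 2 with hq
  have hid : (1 + q) * (φ z - z) = z * ((rogosinski φ ρ z - c) + (c - 1) - q) := by
    have := mul_rogosinski h0 ρ z
    rw [← hq] at this
    linear_combination -this
  have h1q : 1 - t ^ 2 ≤ ‖1 + q‖ := by
    have := norm_sub_norm_le (1 : ℂ) (-q)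
    rw [norm_neg, norm_one, sub_neg_eq_add] at this
    linarith
  have hnorm := congrArg norm hid
  rw [norm_mul, norm_mul] at hnorm
  have hR : ‖(rogosinski φ ρ z - c) + (c - 1) - q‖ ≤ 32 / 5 * t := by
    refine (norm_sub_le _ _).trans ?_
    have := norm_add_le (rogosinski φ ρ z - c) (c - 1)
    have := hb3 z hz
    linarith
  have hfin : 99 / 100 * ‖φ z - z‖ ≤ N * (32 / 5 * t) := by
    calc 99 / 100 * ‖φ z - z‖ ≤ ‖1 + q‖ * ‖φ z - z‖ := by gcongr; nlinarith
      _ ≤ N * (32 / 5 * t) := by rw [hnorm]; gcongr; linarith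
  have e : 7 * N ^ 2 / ρ = 7 * (N * t) := by rw [ht]; ring
  have : 0 ≤ N * t := mul_nonneg (by linarith) ht0
  rw [e]; nlinarith

/-- The Schwarz reflection of `f ∘ exp` across the imaginary axis. -/
def expReflection (f : ℂ → ℂ) (z : ℂ) : ℂ :=
  if z.re ≤ 0 then f (exp z) else (conj (f (exp (-conj z))))⁻¹

lemma expReflection_ne_zero {f : ℂ → ℂ} {R : ℝ}
    (h : ∀ w : ℂ, Real.exp (-R) < ‖w‖ → ‖w‖ ≤ 1 → f w ≠ 0) {z : ℂ} (hz : z ∈ ball (0 : ℂ) R) :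
    expReflection f z ≠ 0 := by
  have hre := abs_lt.1 ((abs_re_le_norm z).trans_lt (mem_ball_zero_iff.1 hz))
  unfold expReflection
  split_ifs with hz0
  · exact h _ (by rw [norm_exp]; exact Real.exp_lt_exp.2 hre.1)
      (by rw [norm_exp]; exact Real.exp_le_one_iff.2 hz0)
  · refine inv_ne_zero ((map_ne_zero _).2 (h _ ?_ ?_))
    · rw [norm_exp]; exact Real.exp_lt_exp.2 (by simp; linarith)
    · rw [norm_exp]; exact Real.exp_le_one_iff.2 (by simp; linarith)

lemma differentiableOn_expReflection {f : ℂ → ℂ} {R : ℝ}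
    (hc : ContinuousOn f {w | Real.exp (-R) < ‖w‖ ∧ ‖w‖ ≤ 1})
    (hd : DifferentiableOn ℂ f {w | Real.exp (-R) < ‖w‖ ∧ ‖w‖ < 1})
    (h : ∀ w : ℂ, Real.exp (-R) < ‖w‖ → ‖w‖ ≤ 1 → f w ≠ 0)
    (h1 : ∀ w : ℂ, ‖w‖ = 1 → ‖f w‖ = 1) :
    DifferentiableOn ℂ (expReflection f) (ball 0 R) := by
  have hre : ∀ z ∈ ball (0 : ℂ) R, -R < z.re ∧ z.re < R := fun z hz ↦
    abs_lt.1 ((abs_re_le_norm z).trans_lt (mem_ball_zero_iff.1 hz))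
  have hopen : IsOpen {w : ℂ | Real.exp (-R) < ‖w‖ ∧ ‖w‖ < 1} :=
    (isOpen_lt continuous_const continuous_norm).inter (isOpen_lt continuous_norm continuous_const)
  have hgd : ∀ z : ℂ, -R < z.re → z.re < 0 → DifferentiableAt ℂ (fun z ↦ f (exp z)) z := by
    intro z hz1 hz2
    refine DifferentiableAt.comp z (hd.differentiableAt (hopen.mem_nhds ⟨?_, ?_⟩))
      differentiable_exp.differentiableAt
    · rw [norm_exp]; exact Real.exp_lt_exp.2 hz1
    · rw [norm_exp]; exact Real.exp_lt_one_iff.2 hz2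
  have hcl : closure {z : ℂ | z.re ≤ 0} = {z | z.re ≤ 0} :=
    (isClosed_le continuous_re continuous_const).closure_eq
  have hcl' : closure {z : ℂ | ¬ z.re ≤ 0} ⊆ {z | 0 ≤ z.re} :=
    closure_minimal (fun z hz ↦ (not_le.1 hz).le) (isClosed_le continuous_const continuous_re)
  refine differentiableOn_of_continuousOn_of_re_ne_zero isOpen_ball ?_ fun z hz hz0 ↦ ?_
  · refine ContinuousOn.if (fun z hz ↦ ?_) ?_ ?_
    · have hz0 : z.re = 0 := by
        have := hz.2
        rw [frontier_setOfPred_re_le] at this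
        exact this
      have e : -conj z = z := by apply Complex.ext <;> simp [hz0]
      have hn := h1 (exp z) (by rw [norm_exp, hz0, Real.exp_zero])
      rw [e]
      refine eq_inv_of_mul_eq_one_left ?_
      rw [mul_conj, normSq_eq_norm_sq, hn]
      simp
    · rw [hcl]
      refine hc.comp continuous_exp.continuousOn fun z hz ↦ ⟨?_, ?_⟩
      · rw [norm_exp]; exact Real.exp_lt_exp.2 (hre z hz.1).1
      · rw [norm_exp]; exact Real.exp_le_one_iff.2 hz.2
    · have hm : MapsTo (fun z : ℂ ↦ exp (-conj z)) (ball 0 R ∩ closure {z : ℂ | ¬ z.re ≤ 0})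
          {w | Real.exp (-R) < ‖w‖ ∧ ‖w‖ ≤ 1} := by
        intro z hz
        have h1 := (hre z hz.1).2
        have h2 : 0 ≤ z.re := hcl' hz.2
        refine ⟨?_, ?_⟩
        · rw [norm_exp]; exact Real.exp_lt_exp.2 (by simp; linarith)
        · rw [norm_exp]; exact Real.exp_le_one_iff.2 (by simp; linarith)
      refine ContinuousOn.inv₀ (continuous_conj.comp_continuousOn (hc.comp ?_ hm)) fun z hz ↦ ?_
      · fun_prop
      · exact (map_ne_zero _).2 (h _ (hm hz).1 (hm hz).2)
  · rcases lt_or_gt_of_ne hz0 with hneg | hpos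
    · refine (hgd z (hre z hz).1 hneg).congr_of_eventuallyEq ?_
      filter_upwards [(isOpen_lt continuous_re continuous_const).mem_nhds hneg] with w hw
      exact if_pos (le_of_lt hw)
    · have hd1 : DifferentiableAt ℂ (fun z ↦ f (exp (-z))) (conj z) :=
        (hgd (-conj z) (by simp; linarith [(hre z hz).2]) (by simpa using hpos)).comp (conj z)
          differentiable_neg.differentiableAt
      have hd2 := hd1.conj_conj
      rw [conj_conj] at hd2
      have hne := expReflection_ne_zero h hz
      rw [expReflection, if_neg (not_le.2 hpos)] at hne
      refine (hd2.inv fun h0 ↦ hne (inv_eq_zero.2 h0)).congr_of_eventuallyEq ?_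
      filter_upwards [(isOpen_lt continuous_const continuous_re).mem_nhds hpos] with w hw
      exact if_neg (not_le.2 hw)

/-- A univalent zero-free map of a thick annulus into the disc, preserving the unit circle and
fixing `1`, is close to the identity away from the origin. -/
lemma norm_sub_self_le_of_annulus {f : ℂ → ℂ} {R ρ N : ℝ} (hN : 2 * Real.pi ≤ N)
    (hNρ : 10 * N ≤ ρ) (hNρ' : 7 * N ^ 2 ≤ ρ) (hρR : ρ < R)
    (hc : ContinuousOn f {w | Real.exp (-R) < ‖w‖ ∧ ‖w‖ ≤ 1})
    (hd : DifferentiableOn ℂ f {w | Real.exp (-R) < ‖w‖ ∧ ‖w‖ < 1})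
    (hinj : InjOn f {w | Real.exp (-R) < ‖w‖ ∧ ‖w‖ < 1})
    (h0 : ∀ w : ℂ, Real.exp (-R) < ‖w‖ → ‖w‖ < 1 → f w ≠ 0)
    (hlt : ∀ w : ℂ, Real.exp (-R) < ‖w‖ → ‖w‖ < 1 → ‖f w‖ < 1)
    (h1 : ∀ w : ℂ, ‖w‖ = 1 → ‖f w‖ = 1) (hf1 : f 1 = 1)
    {z : ℂ} (hz : Real.exp (2 * Real.pi - N) ≤ ‖z‖) (hz1 : ‖z‖ ≤ 1) :
    ‖f z - z‖ ≤ 14 * N ^ 2 / ρ := by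
  have hpi := Real.pi_gt_three
  have hρ : 0 < ρ := by linarith
  have hne : ∀ w : ℂ, Real.exp (-R) < ‖w‖ → ‖w‖ ≤ 1 → f w ≠ 0 := by
    intro w hw hw1 hfw
    rcases hw1.lt_or_eq with h | h
    · exact h0 w hw h hfw
    · have := h1 w h
      simp [hfw] at this
  have hre : ∀ z ∈ ball (0 : ℂ) R, -R < z.re ∧ z.re < R := fun z hz ↦
    abs_lt.1 ((abs_re_le_norm z).trans_lt (mem_ball_zero_iff.1 hz))
  obtain ⟨φ, hφ, hφ0, hφe⟩ := exists_differentiableOn_log (by linarith)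
    (differentiableOn_expReflection hc hd hne h1) (fun z hz ↦ expReflection_ne_zero hne hz)
    (by simp [expReflection, hf1])
  have hnorm : ∀ z ∈ ball (0 : ℂ) R, Real.exp (φ z).re = ‖expReflection f z‖ := fun z hz ↦ by
    rw [← hφe z hz, norm_exp]
  have hleft : ∀ z ∈ ball (0 : ℂ) R, z.re ≤ 0 → exp (φ z) = f (exp z) := fun z hz hz0 ↦ by
    rw [hφe z hz, expReflection, if_pos hz0]
  have hmem : ∀ z ∈ ball (0 : ℂ) R, z.re < 0 → Real.exp (-R) < ‖exp z‖ ∧ ‖exp z‖ < 1 := by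
    intro z hz hz0
    rw [norm_exp]
    exact ⟨Real.exp_lt_exp.2 (hre z hz).1, Real.exp_lt_one_iff.2 hz0⟩
  have hneg : ∀ z ∈ ball (0 : ℂ) R, z.re < 0 → (φ z).re < 0 := by
    intro z hz hz0
    rw [← Real.exp_lt_one_iff, ← norm_exp, hleft z hz hz0.le]
    exact hlt _ (hmem z hz hz0).1 (hmem z hz hz0).2
  have hax : ∀ z ∈ ball (0 : ℂ) R, z.re = 0 → (φ z).re = 0 := by
    intro z hz hz0
    rw [← Real.exp_eq_one_iff, ← norm_exp, hleft z hz hz0.le]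
    exact h1 _ (by rw [norm_exp, hz0, Real.exp_zero])
  have hnn : ∀ z ∈ ball (0 : ℂ) R, 0 ≤ z.re → 0 ≤ (φ z).re := by
    intro z hz hz0
    rcases hz0.eq_or_lt with h | h
    · exact (hax z hz h.symm).ge
    · have hz' : -conj z ∈ ball (0 : ℂ) R := by simpa using hz
      have hm := hmem _ hz' (by simpa using h)
      rw [← Real.one_le_exp_iff, hnorm z hz, expReflection, if_neg (not_le.2 h), norm_inv,
        norm_conj]
      exact (one_le_inv₀ (norm_pos_iff.2 (h0 _ hm.1 hm.2))).2 (hlt _ hm.1 hm.2).le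
  have hpb : (2 * Real.pi * I : ℂ) ∈ ball (0 : ℂ) R := by
    simp [abs_of_pos Real.pi_pos]; linarith
  obtain ⟨k, hk⟩ := exp_eq_one_iff.1 (show exp (φ (2 * Real.pi * I)) = 1 by
    rw [hleft _ hpb (by simp), exp_two_pi_mul_I, hf1])
  have hlog : ‖log z‖ ≤ N := by
    refine (norm_le_abs_re_add_abs_im _).trans ?_
    rw [log_re, log_im]
    have hz0 : 0 < ‖z‖ := (Real.exp_pos _).trans_le hz
    have := (Real.le_log_iff_exp_le hz0).2 hz
    rw [abs_of_nonpos (Real.log_nonpos (norm_nonneg _) hz1)]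
    linarith [abs_arg_le_pi z]
  have hzne : z ≠ 0 := norm_pos_iff.1 ((Real.exp_pos _).trans_le hz)
  have key := norm_sub_self_le hN hNρ hρR hφ hφ0 hneg hnn hax (k := k) (by rw [hk]; ring)
    (fun z hz w hw hz0 hw0 he ↦ hinj (hmem z hz hz0) (hmem w hw hw0) (by
      rwa [hleft z hz hz0.le, hleft w hw hw0.le] at he)) hlog
  have hlb : log z ∈ ball (0 : ℂ) R := by simp only [mem_ball_zero_iff]; linarith
  have hfz : f z = z * exp (φ (log z) - log z) := by
    have := hleft _ hlb (by rw [log_re]; exact Real.log_nonpos (norm_nonneg _) hz1)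
    rw [exp_log hzne] at this
    rw [exp_sub, exp_log hzne, this]; field_simp
  have hsmall : 7 * N ^ 2 / ρ ≤ 1 := (div_le_one hρ).2 hNρ'
  have e : f z - z = z * (exp (φ (log z) - log z) - 1) := by rw [hfz]; ring
  rw [e, norm_mul]
  calc ‖z‖ * ‖exp (φ (log z) - log z) - 1‖ ≤ 1 * (2 * (7 * N ^ 2 / ρ)) := by
        gcongr
        exact (norm_exp_sub_one_le (key.trans hsmall)).trans (by gcongr)
    _ = 14 * N ^ 2 / ρ := by ring

lemma isPreconnected_annulus {a : ℝ} (ha : 0 < a) :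
    IsPreconnected {w : ℂ | a < ‖w‖ ∧ ‖w‖ < 1} := by
  have hconv : Convex ℝ {z : ℂ | Real.log a < z.re ∧ z.re < 0} :=
    (convex_halfSpace_re_gt _).inter (convex_halfSpace_re_lt _)
  convert hconv.isPreconnected.image exp continuous_exp.continuousOn using 1
  ext w
  constructor
  · rintro ⟨h1, h2⟩
    have hw := ha.trans h1
    refine ⟨log w, ⟨?_, ?_⟩, exp_log (norm_pos_iff.1 hw)⟩
    · rw [log_re]; exact Real.log_lt_log ha h1
    · rw [log_re]; exact Real.log_neg hw h2
  · rintro ⟨z, ⟨h1, h2⟩, rfl⟩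
    refine ⟨?_, ?_⟩ <;> rw [norm_exp]
    · exact (Real.log_lt_iff_lt_exp ha).1 h1
    · exact Real.exp_lt_one_iff.2 h2

/-- A univalent map of the annulus `η < |w| < 1` that preserves the unit circle and sends the inner
circle into the disc of radius `s` covers the annulus `s < |w| < 1` as soon as it meets it. -/
lemma annulus_subset_image {f : ℂ → ℂ} {η s : ℝ} (hη : 0 < η) (hs : 0 < s)
    (hc : ContinuousOn f {w | η ≤ ‖w‖ ∧ ‖w‖ ≤ 1})
    (hd : DifferentiableOn ℂ f {w | η < ‖w‖ ∧ ‖w‖ < 1})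
    (hinj : InjOn f {w | η < ‖w‖ ∧ ‖w‖ < 1})
    (h1 : ∀ w : ℂ, ‖w‖ = 1 → ‖f w‖ = 1) (hin : ∀ w : ℂ, ‖w‖ = η → ‖f w‖ ≤ s)
    (hmeet : ∃ w : ℂ, (η < ‖w‖ ∧ ‖w‖ < 1) ∧ s < ‖f w‖ ∧ ‖f w‖ < 1) :
    {w : ℂ | s < ‖w‖ ∧ ‖w‖ < 1} ⊆ f '' {w | η < ‖w‖ ∧ ‖w‖ < 1} := by
  obtain ⟨w₀, hw₀, hfw₀⟩ := hmeet
  have hΩ : IsOpen {w : ℂ | η < ‖w‖ ∧ ‖w‖ < 1} :=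
    (isOpen_lt continuous_const continuous_norm).inter (isOpen_lt continuous_norm continuous_const)
  have hK : IsCompact {w : ℂ | η ≤ ‖w‖ ∧ ‖w‖ ≤ 1} := by
    refine (isCompact_closedBall (0 : ℂ) 1).of_isClosed_subset ?_ fun w hw ↦ by simpa using hw.2
    exact (isClosed_le continuous_const continuous_norm).inter
      (isClosed_le continuous_norm continuous_const)
  have hsub : f '' {w | η < ‖w‖ ∧ ‖w‖ < 1} ⊆ f '' {w | η ≤ ‖w‖ ∧ ‖w‖ ≤ 1} :=
    image_mono fun w hw ↦ ⟨hw.1.le, hw.2.le⟩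
  have hopen : IsOpen (f '' {w | η < ‖w‖ ∧ ‖w‖ < 1}) := by
    refine ((hd.analyticOnNhd hΩ).is_constant_or_isOpen (isPreconnected_annulus hη)).resolve_left
      ?_ _ subset_rfl hΩ
    rintro ⟨c, hcst⟩
    have hw₀' : η < ‖-w₀‖ ∧ ‖-w₀‖ < 1 := by rwa [norm_neg]
    have := hinj hw₀ hw₀' ((hcst _ hw₀).trans (hcst _ hw₀').symm)
    have h0 : w₀ = 0 := self_eq_neg.1 this
    rw [h0, norm_zero] at hw₀
    exact hη.not_gt hw₀.1
  refine (isPreconnected_annulus hs).subset_left_of_subset_union hopen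
    (hK.image_of_continuousOn hc).isClosed.isOpen_compl
    (disjoint_compl_right.mono_left hsub) (fun w hw ↦ ?_) ⟨f w₀, hfw₀, w₀, hw₀, rfl⟩
  by_cases hwK : w ∈ f '' {w | η ≤ ‖w‖ ∧ ‖w‖ ≤ 1}
  · left
    obtain ⟨z, hz, rfl⟩ := hwK
    refine ⟨z, ⟨lt_of_le_of_ne hz.1 fun h ↦ ?_, lt_of_le_of_ne hz.2 fun h ↦ ?_⟩, rfl⟩
    · exact (hin z h.symm).not_gt hw.1
    · exact hw.2.ne (h1 z h)
  · exact Or.inr hwK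

lemma mem_closure_of_norm_le_one {A : Set ℂ} {r : ℝ} (hA : {w : ℂ | r < ‖w‖ ∧ ‖w‖ < 1} ⊆ A)
    (hr : 0 ≤ r) {w : ℂ} (hw : r < ‖w‖) (hw1 : ‖w‖ ≤ 1) : w ∈ closure A := by
  have ht : Tendsto (fun t : ℝ ↦ (t : ℂ) * w) (𝓝[<] 1) (𝓝 w) := by
    have : Continuous (fun t : ℝ ↦ (t : ℂ) * w) := by fun_prop
    simpa using (this.tendsto 1).mono_left nhdsWithin_le_nhds
  refine mem_closure_of_tendsto ht ?_
  have h0 : ∀ᶠ t : ℝ in 𝓝[<] 1, 0 < t :=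
    (lt_mem_nhds one_pos).filter_mono nhdsWithin_le_nhds
  filter_upwards [ht.norm.eventually (lt_mem_nhds hw), self_mem_nhdsWithin, h0] with t h1 h2 h3
  refine hA ⟨h1, ?_⟩
  rw [norm_mul, norm_real, Real.norm_of_nonneg h3.le]
  have : t < 1 := h2
  nlinarith [hr.trans_lt hw]

end Helpers

/-- Comparison of annular domains (Lemma 4.3 of the paper): let `A, B ⊆ 𝔻` be annular
domains with outer boundary `∂𝔻`, sandwiched between round annuli,
`𝔻 \ closedBall(0, Cδ) ⊆ A ⊆ 𝔻 \ closedBall(0, δ/C)` (and similarly for `B` with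
constants `C', δ'`), and let `f : A → B` be a conformal equivalence mapping outer boundary
to outer boundary (hence inner to inner; in particular the two domains have the same
conformal modulus), normalized so that `f 1 = 1`.  Then `f` is uniformly close to the
identity, at a rate depending only on the constants: for each `ε > 0` there is `r₀ > 0`
such that whenever `Cδ ≤ r₀` and `C'δ' ≤ r₀` one has `dist (f z) z ≤ ε` on `A`. -/
theorem annulus_maps_converge_to_identity :
    ∀ ε : ℝ, 0 < ε → ∃ r₀ : ℝ, 0 < r₀ ∧
      ∀ (A B : Set ℂ) (C δ C' δ' : ℝ) (f : ℂ → ℂ),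
        IsOpen A → IsOpen B → IsConnected A → IsConnected B →
        1 < C → 0 < δ → 1 < C' → 0 < δ' →
        Metric.ball 0 1 \ Metric.closedBall 0 (C * δ) ⊆ A →
        A ⊆ Metric.ball 0 1 \ Metric.closedBall 0 (δ / C) →
        Metric.ball 0 1 \ Metric.closedBall 0 (C' * δ') ⊆ B →
        B ⊆ Metric.ball 0 1 \ Metric.closedBall 0 (δ' / C') →
        C * δ ≤ r₀ → C' * δ' ≤ r₀ →
        DifferentiableOn ℂ f A → Set.BijOn f A B →
        ContinuousOn f (closure A) → Set.MapsTo f (closure A) (closure B) →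
        Set.MapsTo f (Metric.sphere 0 1) (Metric.sphere 0 1) →
        f 1 = 1 →
        ∀ z ∈ A, dist (f z) z ≤ ε := by
  intro ε hε
  have hpi := Real.pi_gt_three
  set e := min ε 1 / 4 with he
  have he0 : 0 < e := div_pos (lt_min hε one_pos) (by norm_num)
  have heε : 4 * e ≤ ε := by rw [he]; linarith [min_le_left ε 1]
  have he1 : e ≤ 1 / 4 := by rw [he]; linarith [min_le_right ε 1]
  set N := 2 * Real.pi - Real.log e with hNdef
  have hN : 2 * Real.pi ≤ N := by linarith [Real.log_nonpos he0.le (by linarith)]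
  have hexpN : Real.exp (2 * Real.pi - N) = e := by
    rw [hNdef, sub_sub_cancel, Real.exp_log he0]
  set ρ := 10 * N + 14 * N ^ 2 / e with hρdef
  have hquot : 14 * N ^ 2 ≤ 14 * N ^ 2 / e := le_div_self (by positivity) he0 (by linarith)
  have hNρ : 10 * N ≤ ρ := by linarith [show 0 ≤ 14 * N ^ 2 / e by positivity]
  have hNρ' : 7 * N ^ 2 ≤ ρ := by nlinarith [sq_nonneg N]
  have hρ : 0 < ρ := by linarith
  have hρe : 14 * N ^ 2 / ρ ≤ e := by
    have : 14 * N ^ 2 / e ≤ ρ := by linarith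
    rw [div_le_iff₀ he0] at this
    rw [div_le_iff₀ hρ]
    linarith
  have hre : Real.exp (-(ρ + 1)) < e := by
    rw [← hexpN]; exact Real.exp_lt_exp.2 (by linarith)
  refine ⟨Real.exp (-(ρ + 1)), Real.exp_pos _, ?_⟩
  intro A B C δ C' δ' f _ _ _ _ _ _ hC' hδ' hAsub hA1 _ hB1 hr _ hd hbij hc _ hsph hf1 z hz
  have hΩ : {w : ℂ | Real.exp (-(ρ + 1)) < ‖w‖ ∧ ‖w‖ < 1} ⊆ A := fun w hw ↦
    hAsub ⟨by simpa using hw.2, by simpa using hr.trans_lt hw.1⟩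
  have hBpos : ∀ w ∈ B, 0 < ‖w‖ ∧ ‖w‖ < 1 := fun w hw ↦ by
    have := hB1 hw
    refine ⟨?_, by simpa using this.1⟩
    have h2 : δ' / C' < ‖w‖ := by simpa using this.2
    exact lt_trans (by positivity) h2
  have hcl : ContinuousOn f {w | Real.exp (-(ρ + 1)) < ‖w‖ ∧ ‖w‖ ≤ 1} := hc.mono fun w hw ↦
    mem_closure_of_norm_le_one hΩ (Real.exp_pos _).le hw.1 hw.2
  have h1 : ∀ w : ℂ, ‖w‖ = 1 → ‖f w‖ = 1 := fun w hw ↦ by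
    simpa using hsph (show w ∈ Metric.sphere (0 : ℂ) 1 by simpa using hw)
  have hfB : ∀ w : ℂ, Real.exp (-(ρ + 1)) < ‖w‖ → ‖w‖ < 1 → 0 < ‖f w‖ ∧ ‖f w‖ < 1 :=
    fun w hw hw1 ↦ hBpos _ (hbij.mapsTo (hΩ ⟨hw, hw1⟩))
  have hnear : ∀ w : ℂ, e ≤ ‖w‖ → ‖w‖ ≤ 1 → ‖f w - w‖ ≤ e := fun w hw hw1 ↦
    (norm_sub_self_le_of_annulus hN hNρ hNρ' (lt_add_one ρ) hcl (hd.mono hΩ)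
      (hbij.injOn.mono hΩ) (fun w hw hw1 ↦ norm_pos_iff.1 (hfB w hw hw1).1)
      (fun w hw hw1 ↦ (hfB w hw hw1).2) h1 hf1 (by rwa [hexpN]) hw1).trans hρe
  have hz1 : ‖z‖ < 1 := by simpa using (hA1 hz).1
  rw [dist_eq_norm]
  rcases le_or_gt e ‖z‖ with hze | hze
  · linarith [hnear z hze hz1.le]
  have hsub : {w : ℂ | e < ‖w‖ ∧ ‖w‖ < 1} ⊆ A := fun w hw ↦ hΩ ⟨hre.trans hw.1, hw.2⟩
  have hn : ‖(7 / 8 : ℂ)‖ = 7 / 8 := by norm_num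
  have hcover := annulus_subset_image (f := f) (s := 2 * e) he0 (by positivity)
    (hcl.mono fun w hw ↦ ⟨hre.trans_le hw.1, hw.2⟩) (hd.mono hsub) (hbij.injOn.mono hsub) h1
    (fun w hw ↦ by linarith [hnear w hw.ge (by linarith), norm_sub_norm_le (f w) w])
    ⟨7 / 8, by rw [hn]; constructor <;> linarith, by
      have := hnear (7 / 8) (by rw [hn]; linarith) (by rw [hn]; norm_num)
      have := norm_sub_norm_le (7 / 8 : ℂ) (f (7 / 8))
      rw [norm_sub_rev] at this
      linarith, (hfB _ (by rw [hn]; linarith) (by rw [hn]; norm_num)).2⟩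
  have hfz : ‖f z‖ ≤ 2 * e := by
    by_contra! h
    obtain ⟨w, hw, hwz⟩ := hcover ⟨h, (hBpos _ (hbij.mapsTo hz)).2⟩
    have := hbij.injOn (hsub hw) hz hwz
    rw [this] at hw
    exact hw.1.not_gt hze
  linarith [norm_sub_le (f z) z]
end
end
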